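/- arXiv:1308.2034 — 2 statements merged into one kernel-verified Lean document; each statement's English description precedes it below -/
import Mathlib

section
/- Let A = K[X_1,…,X_n], F a weighted free graded A-module, and M ⊆ F a graded submodule. Then for all i and j, the graded Betti numbers satisfy β_{ij}(F/M) ≤ β_{ij}(F/in_{(ω,ε)}(M)). -/
/-!  Basic setup: the polynomial ring `A = K[X_1,…,X_n]`, a graded free module
`F = ⊕_{j} A(-d_j)` realized as `Fin k → A`, weight orders `(ω, ε)`, initial
modules, Hilbert functions, graded free resolutions, Betti numbers,
regularity and componentwise notions, following Caviglia–Varbaro,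
"Componentwise regularity (I)". -/

namespace CregPaper

abbrev A (K : Type*) [Field K] (n : ℕ) := MvPolynomial (Fin n) K

variable {K : Type*} [Field K] {n k : ℕ}

/-- `(ω)`-weight of an exponent vector `u`. -/
def wdeg (ω : Fin n → ℕ) (u : Fin n →₀ ℕ) : ℕ := u.sum fun i e => ω i * e

/-- total (standard) degree of an exponent vector `u`. -/
def tdeg (u : Fin n →₀ ℕ) : ℕ := u.sum fun _ e => e

/-- largest `(ω,ε)`-weight of a monomial in the support of `f ∈ F`. -/
noncomputable def maxWt (ω : Fin n → ℕ) (ε : Fin k → ℕ) (f : Fin k → A K n) : ℕ :=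
  Finset.univ.sup fun j => (f j).support.sup fun u => wdeg ω u + ε j

/-- the initial part `in_{(ω,ε)}(f)`: the sum of the terms of `f` of largest weight. -/
noncomputable def inForm (ω : Fin n → ℕ) (ε : Fin k → ℕ) (f : Fin k → A K n) :
    Fin k → A K n :=
  fun j => ∑ u ∈ (f j).support.filter fun u => wdeg ω u + ε j = maxWt ω ε f,
    MvPolynomial.monomial u ((f j).coeff u)

/-- the initial module `in_{(ω,ε)}(M)`. -/
noncomputable def inMod (ω : Fin n → ℕ) (ε : Fin k → ℕ)
    (M : Submodule (A K n) (Fin k → A K n)) : Submodule (A K n) (Fin k → A K n) :=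
  Submodule.span (A K n) {g | ∃ f ∈ M, f ≠ 0 ∧ g = inForm ω ε f}

/-- `f ∈ F = ⊕_j A(-d_j)` is homogeneous of (standard) degree `a`. -/
def IsHomog (d : Fin k → ℕ) (a : ℕ) (f : Fin k → A K n) : Prop :=
  ∀ j, ∀ u ∈ (f j).support, tdeg u + d j = a

/-- the `K`-subspace of `F` of homogeneous elements of degree `a`. -/
noncomputable def homogSub (d : Fin k → ℕ) (a : ℕ) : Submodule K (Fin k → A K n) where
  carrier := {f | IsHomog d a f}
  add_mem' := by
    intro f g hf hg j u hu
    rcases Finset.mem_union.mp (MvPolynomial.support_add hu) with h | h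
    · exact hf j u h
    · exact hg j u h
  zero_mem' := by intro j u hu; simp at hu
  smul_mem' := by
    intro c f hf j u hu
    exact hf j u (MvPolynomial.support_smul hu)

/-- the degree-`a` homogeneous component of `f ∈ F`. -/
noncomputable def homogComp (d : Fin k → ℕ) (f : Fin k → A K n) (a : ℕ) : Fin k → A K n :=
  fun j => ∑ u ∈ (f j).support.filter fun u => tdeg u + d j = a,
    MvPolynomial.monomial u ((f j).coeff u)

/-- `M ⊆ F` is a graded submodule. -/
def IsGradedSub (d : Fin k → ℕ) (M : Submodule (A K n) (Fin k → A K n)) : Prop :=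
  ∀ f ∈ M, ∀ a, homogComp d f a ∈ M

/-- Hilbert function of `M ⊆ F` in degree `a`. -/
noncomputable def hilb (d : Fin k → ℕ) (M : Submodule (A K n) (Fin k → A K n)) (a : ℕ) : ℕ :=
  Module.finrank K ↥(Submodule.restrictScalars K M ⊓ homogSub d a)

/-- the homogeneous maximal ideal `m = (X_1,…,X_n)` of `A`. -/
noncomputable def mIdeal (K : Type*) [Field K] (n : ℕ) : Ideal (A K n) :=
  RingHom.ker (MvPolynomial.constantCoeff : A K n →+* K)

/-- graded Betti number `β_{0,a}(M) = dim_K (M/mM)_a`, the number of minimal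
generators of the graded module `M` in degree `a`. -/
noncomputable def beta0 (d : Fin k → ℕ) (M : Submodule (A K n) (Fin k → A K n)) (a : ℕ) : ℕ :=
  hilb d M a - hilb d (mIdeal K n • M) a

/-- A graded free resolution of a graded submodule `M` of `F = ⊕_j A(-d_j)`:
`⋯ → A^{rk 1} → A^{rk 0} → M → 0`, each free module coming with degree shifts
`sh i`, all maps graded of degree `0`. -/
structure GFRes (d : Fin k → ℕ) (M : Submodule (A K n) (Fin k → A K n)) where
  rk : ℕ → ℕ
  sh : (i : ℕ) → Fin (rk i) → ℕ
  aug : (Fin (rk 0) → A K n) →ₗ[A K n] (Fin k → A K n)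
  diff : (i : ℕ) → ((Fin (rk (i+1)) → A K n) →ₗ[A K n] (Fin (rk i) → A K n))
  aug_range : LinearMap.range aug = M
  aug_hom : ∀ l, IsHomog d (sh 0 l) (aug (Pi.single l 1))
  diff_hom : ∀ i l, IsHomog (sh i) (sh (i+1) l) (diff i (Pi.single l 1))
  ex0 : LinearMap.range (diff 0) = LinearMap.ker aug
  exs : ∀ i, LinearMap.range (diff (i+1)) = LinearMap.ker (diff i)

/-- minimality of a graded free resolution: all entries of the differential
matrices lie in the maximal ideal. -/
def GFRes.Minimal {d : Fin k → ℕ} {M : Submodule (A K n) (Fin k → A K n)}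
    (res : GFRes d M) : Prop :=
  ∀ i x l, res.diff i x l ∈ mIdeal K n

/-- the graded Betti number `β_{i,j}(M)` read off from a (minimal) resolution. -/
noncomputable def GFRes.betti {d : Fin k → ℕ} {M : Submodule (A K n) (Fin k → A K n)}
    (res : GFRes d M) (i j : ℕ) : ℕ :=
  (Finset.univ.filter fun l => res.sh i l = j).card

/-- `reg_A(M) ≤ r`: there is a minimal graded free resolution of `M` with
all shifts in homological degree `i` bounded by `i + r`. -/
def RegLE (d : Fin k → ℕ) (M : Submodule (A K n) (Fin k → A K n)) (r : ℕ) : Prop :=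
  ∃ res : GFRes d M, res.Minimal ∧ ∀ i l, res.sh i l ≤ i + r

/-- `M_{⟨a⟩}`: the submodule generated by the homogeneous elements of degree `a` of `M`. -/
noncomputable def compSub (d : Fin k → ℕ) (M : Submodule (A K n) (Fin k → A K n)) (a : ℕ) :
    Submodule (A K n) (Fin k → A K n) :=
  Submodule.span (A K n) {f | f ∈ M ∧ IsHomog d a f}

/-- `M` is `r`-componentwise regular: `reg (M_{⟨a⟩}) ≤ a + r` for all `a`. -/
def CWRegLE (d : Fin k → ℕ) (M : Submodule (A K n) (Fin k → A K n)) (r : ℕ) : Prop :=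
  ∀ a, RegLE d (compSub d M a) (a + r)

/-- `M` is componentwise linear: each `M_{⟨a⟩}` is zero or has regularity `a`. -/
def CompLinear (d : Fin k → ℕ) (M : Submodule (A K n) (Fin k → A K n)) : Prop :=
  ∀ a, compSub d M a = ⊥ ∨ RegLE d (compSub d M a) a

/-- `M` is generated in degrees `≤ a`. -/
def GenInDegLE (d : Fin k → ℕ) (M : Submodule (A K n) (Fin k → A K n)) (a : ℕ) : Prop :=
  M ≤ Submodule.span (A K n) {f | f ∈ M ∧ ∃ b ≤ a, IsHomog d b f}

end CregPaper

namespace CregPaper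

open MvPolynomial

section Weights

variable {K : Type*} [Field K] {n k : ℕ}

theorem wdeg_add (ω : Fin n → ℕ) (u v : Fin n →₀ ℕ) :
    wdeg ω (u + v) = wdeg ω u + wdeg ω v :=
  Finsupp.sum_add_index' (by simp) (by simp [mul_add])

theorem tdeg_eq_wdeg_one (u : Fin n →₀ ℕ) : tdeg u = wdeg 1 u := by
  simp [tdeg, wdeg]

theorem wdeg_one_eq_zero_iff (u : Fin n →₀ ℕ) : wdeg 1 u = 0 ↔ u = 0 := by
  simp [wdeg, Finsupp.sum, Finsupp.ext_iff]

/-- The elements of `F` all of whose terms have `(ω,ε)`-weight in `P`. -/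
def wtSub (ω : Fin n → ℕ) (ε : Fin k → ℕ) (P : Set ℕ) : Submodule K (Fin k → A K n) where
  carrier := {f | ∀ j u, (f j).coeff u ≠ 0 → wdeg ω u + ε j ∈ P}
  add_mem' := by
    intro f g hf hg j u hu
    by_cases h : (f j).coeff u = 0
    · exact hg j u fun h' => hu (by simp [h, h'])
    · exact hf j u h
  zero_mem' := by intro j u hu; simp at hu
  smul_mem' := by
    intro c f hf j u hu
    exact hf j u fun h => hu (by simp [h])

theorem mem_wtSub {ω : Fin n → ℕ} {ε : Fin k → ℕ} {P : Set ℕ} {f : Fin k → A K n} :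
    f ∈ wtSub ω ε P ↔ ∀ j u, (f j).coeff u ≠ 0 → wdeg ω u + ε j ∈ P := Iff.rfl

theorem wtSub_mono {ω : Fin n → ℕ} {ε : Fin k → ℕ} {P Q : Set ℕ} (h : P ⊆ Q) :
    (wtSub ω ε P : Submodule K (Fin k → A K n)) ≤ wtSub ω ε Q :=
  fun _ hf j u hu => h (hf j u hu)

theorem isHomog_iff {d : Fin k → ℕ} {a : ℕ} {f : Fin k → A K n} :
    IsHomog d a f ↔ f ∈ wtSub 1 d {a} := by
  simp [IsHomog, mem_wtSub, tdeg_eq_wdeg_one]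

theorem coeff_sum_filter_support (p : A K n) (P : (Fin n →₀ ℕ) → Prop) [DecidablePred P]
    (v : Fin n →₀ ℕ) :
    (∑ u ∈ p.support.filter P, monomial u (p.coeff u)).coeff v =
      if P v then p.coeff v else 0 := by
  simp only [coeff_sum, coeff_monomial, Finset.sum_ite_eq', Finset.mem_filter, mem_support_iff]
  by_cases h : P v <;> simp +contextual [h]

/-- The projection of `F` onto its part of `(ω,ε)`-weight `w`. -/
noncomputable def wtComp (ω : Fin n → ℕ) (ε : Fin k → ℕ) (w : ℕ) :
    (Fin k → A K n) →ₗ[K] (Fin k → A K n) where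
  toFun f := fun j => ∑ u ∈ (f j).support.filter fun u => wdeg ω u + ε j = w,
    monomial u ((f j).coeff u)
  map_add' f g := by
    ext j v
    refine (coeff_sum_filter_support _ _ v).trans ?_
    simp only [Pi.add_apply, coeff_add, coeff_sum_filter_support]
    split_ifs <;> simp
  map_smul' c f := by
    ext j v
    refine (coeff_sum_filter_support _ _ v).trans ?_
    simp only [Pi.smul_apply, RingHom.id_apply, coeff_smul, coeff_sum_filter_support]
    split_ifs <;> simp

theorem coeff_wtComp (ω : Fin n → ℕ) (ε : Fin k → ℕ) (w : ℕ) (f : Fin k → A K n) (j : Fin k)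
    (v : Fin n →₀ ℕ) :
    (wtComp ω ε w f j).coeff v = if wdeg ω v + ε j = w then (f j).coeff v else 0 :=
  coeff_sum_filter_support _ _ _

theorem homogComp_eq (d : Fin k → ℕ) (f : Fin k → A K n) (a : ℕ) :
    homogComp d f a = wtComp 1 d a f := by
  ext j u
  rw [homogComp, coeff_sum_filter_support, coeff_wtComp, tdeg_eq_wdeg_one]

theorem inForm_eq (ω : Fin n → ℕ) (ε : Fin k → ℕ) (f : Fin k → A K n) :
    inForm ω ε f = wtComp ω ε (maxWt ω ε f) f := rfl

theorem wtComp_mem (ω : Fin n → ℕ) (ε : Fin k → ℕ) (w : ℕ) (f : Fin k → A K n) :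
    wtComp ω ε w f ∈ wtSub ω ε {w} := by
  intro j u hu
  by_contra h
  exact hu (by rw [coeff_wtComp, if_neg (by simpa using h)])

theorem wtComp_mem_wtSub {ω ω' : Fin n → ℕ} {ε ε' : Fin k → ℕ} (w : ℕ) {P : Set ℕ}
    {f : Fin k → A K n} (hf : f ∈ wtSub ω' ε' P) : wtComp ω ε w f ∈ wtSub ω' ε' P := by
  intro j u hu
  refine hf j u fun h => hu ?_
  rw [coeff_wtComp, h, ite_self]

theorem wtComp_of_mem {ω : Fin n → ℕ} {ε : Fin k → ℕ} {w : ℕ} {f : Fin k → A K n}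
    (hf : f ∈ wtSub ω ε {w}) : wtComp ω ε w f = f := by
  ext j u
  rw [coeff_wtComp]
  split_ifs with h
  · rfl
  · by_contra h'
    exact h (hf j u (Ne.symm h'))

theorem wtComp_of_notMem {ω : Fin n → ℕ} {ε : Fin k → ℕ} {w : ℕ} {P : Set ℕ} (hw : w ∉ P)
    {f : Fin k → A K n} (hf : f ∈ wtSub ω ε P) : wtComp ω ε w f = 0 := by
  ext j u
  rw [coeff_wtComp]
  split_ifs with h
  · by_contra h'
    exact hw (h ▸ hf j u h')
  · simp

theorem sub_wtComp_mem {ω : Fin n → ℕ} {ε : Fin k → ℕ} (w : ℕ) {P : Set ℕ}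
    {f : Fin k → A K n} (hf : f ∈ wtSub ω ε P) : f - wtComp ω ε w f ∈ wtSub ω ε (P \ {w}) := by
  intro j u hu
  rw [Pi.sub_apply, coeff_sub, coeff_wtComp] at hu
  split_ifs at hu with h
  · simp at hu
  · exact ⟨hf j u (by simpa using hu), h⟩

theorem mem_wtSub_univ (ω : Fin n → ℕ) (ε : Fin k → ℕ) (f : Fin k → A K n) :
    f ∈ wtSub ω ε Set.univ := fun _ _ _ => trivial

theorem mem_wtSub_maxWt (ω : Fin n → ℕ) (ε : Fin k → ℕ) (f : Fin k → A K n) :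
    f ∈ wtSub ω ε (Set.Iic (maxWt ω ε f)) := by
  intro j u hu
  refine (Finset.le_sup (f := fun u => wdeg ω u + ε j) (mem_support_iff.2 hu)).trans ?_
  exact Finset.le_sup (f := fun j => (f j).support.sup fun u => wdeg ω u + ε j)
    (Finset.mem_univ j)

theorem maxWt_eq {ω : Fin n → ℕ} {ε : Fin k → ℕ} {w : ℕ} {f : Fin k → A K n}
    (hf : f ∈ wtSub ω ε (Set.Iic w)) (h0 : wtComp ω ε w f ≠ 0) : maxWt ω ε f = w := by
  apply le_antisymm
  · exact Finset.sup_le fun j _ => Finset.sup_le fun u hu => hf j u (mem_support_iff.1 hu)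
  · by_contra h
    exact h0 (wtComp_of_notMem (by simpa using h) (mem_wtSub_maxWt ω ε f))

theorem eq_zero_of_mem_Iio_zero {ω : Fin n → ℕ} {ε : Fin k → ℕ} {f : Fin k → A K n}
    (hf : f ∈ wtSub ω ε (Set.Iio 0)) : f = 0 := by
  ext j u
  by_contra h
  exact absurd (hf j u h) (by simp)

theorem sum_wtComp {ω : Fin n → ℕ} {ε : Fin k → ℕ} {N : ℕ} {f : Fin k → A K n}
    (hf : f ∈ wtSub ω ε (Set.Iio N)) : ∑ w ∈ Finset.range N, wtComp ω ε w f = f := by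
  ext j u
  simp only [Finset.sum_apply, coeff_sum, coeff_wtComp, Finset.sum_ite_eq, Finset.mem_range]
  split_ifs with h
  · rfl
  · by_contra h'
    exact h (hf j u (Ne.symm h'))

theorem exists_sum_wtComp (ω : Fin n → ℕ) (ε : Fin k → ℕ) (f : Fin k → A K n) :
    ∃ N, ∑ w ∈ Finset.range N, wtComp ω ε w f = f :=
  ⟨maxWt ω ε f + 1,
    sum_wtComp (wtSub_mono (fun _ h => Nat.lt_succ_of_le h) (mem_wtSub_maxWt ω ε f))⟩

theorem monomial_smul_mem {ω : Fin n → ℕ} {ε : Fin k → ℕ} {P Q : Set ℕ} {f : Fin k → A K n}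
    (hf : f ∈ wtSub ω ε P) (u : Fin n →₀ ℕ) (c : K) (hPQ : ∀ b ∈ P, wdeg ω u + b ∈ Q) :
    (monomial u c : A K n) • f ∈ wtSub ω ε Q := by
  intro j v hv
  rw [Pi.smul_apply, smul_eq_mul, coeff_monomial_mul'] at hv
  split_ifs at hv with h
  · obtain ⟨v, rfl⟩ := exists_add_of_le h
    rw [wdeg_add, add_assoc]
    exact hPQ _ (hf j v fun h0 => hv (by simp [h0]))
  · exact absurd rfl hv

theorem map_eq_sum {r : ℕ} (φ : (Fin r → A K n) →ₗ[A K n] (Fin k → A K n)) (s : Fin r → A K n) :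
    φ s = ∑ l, ∑ u ∈ (s l).support,
      (monomial u ((s l).coeff u) : A K n) • φ (Pi.single l 1) := by
  conv_lhs => rw [pi_eq_sum_univ' s]
  simp only [map_sum, map_smul, ← Finset.sum_smul, support_sum_monomial_coeff]

theorem map_mem_wtSub {r : ℕ} {ω : Fin n → ℕ} {ε : Fin k → ℕ} {ε' : Fin r → ℕ}
    {φ : (Fin r → A K n) →ₗ[A K n] (Fin k → A K n)} {P : Fin r → Set ℕ} {Q R : Set ℕ}
    (hφ : ∀ l, φ (Pi.single l 1) ∈ wtSub ω ε (P l))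
    (hR : ∀ l a, a + ε' l ∈ Q → ∀ b ∈ P l, a + b ∈ R)
    {s : Fin r → A K n} (hs : s ∈ wtSub ω ε' Q) : φ s ∈ wtSub ω ε R := by
  rw [map_eq_sum]
  refine sum_mem fun l _ => sum_mem fun u hu => ?_
  exact monomial_smul_mem (hφ l) _ _ (hR l _ (hs l u (mem_support_iff.1 hu)))

/-- A map of free modules sending basis vectors to homogeneous elements of the right weight. -/
def IsGradedMap {r : ℕ} (ω : Fin n → ℕ) (ε' : Fin r → ℕ) (ε : Fin k → ℕ)
    (φ : (Fin r → A K n) →ₗ[A K n] (Fin k → A K n)) : Prop :=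
  ∀ l, φ (Pi.single l 1) ∈ wtSub ω ε {ε' l}

theorem IsGradedMap.map_mem {r : ℕ} {ω : Fin n → ℕ} {ε' : Fin r → ℕ} {ε : Fin k → ℕ}
    {φ : (Fin r → A K n) →ₗ[A K n] (Fin k → A K n)} (hφ : IsGradedMap ω ε' ε φ) {P : Set ℕ}
    {s : Fin r → A K n} (hs : s ∈ wtSub ω ε' P) : φ s ∈ wtSub ω ε P :=
  map_mem_wtSub hφ (fun _ _ h _ hb => by rwa [Set.mem_singleton_iff.1 hb]) hs

theorem IsGradedMap.map_wtComp {r : ℕ} {ω : Fin n → ℕ} {ε' : Fin r → ℕ} {ε : Fin k → ℕ}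
    {φ : (Fin r → A K n) →ₗ[A K n] (Fin k → A K n)} (hφ : IsGradedMap ω ε' ε φ) (w : ℕ)
    (s : Fin r → A K n) : φ (wtComp ω ε' w s) = wtComp ω ε w (φ s) := by
  have h1 := wtComp_of_mem (hφ.map_mem (wtComp_mem ω ε' w s))
  have h2 := wtComp_of_notMem (w := w) (by simp)
    (hφ.map_mem (sub_wtComp_mem w (mem_wtSub_univ ω ε' s)))
  rw [map_sub, map_sub, sub_eq_zero] at h2
  rw [h2, h1]

theorem inForm_mem_inMod {ω : Fin n → ℕ} {ε : Fin k → ℕ}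
    {M : Submodule (A K n) (Fin k → A K n)} {f : Fin k → A K n} (hf : f ∈ M) {w : ℕ}
    (hw : f ∈ wtSub ω ε (Set.Iic w)) : wtComp ω ε w f ∈ inMod ω ε M := by
  by_cases h0 : wtComp ω ε w f = 0
  · rw [h0]; exact zero_mem _
  · refine Submodule.subset_span ⟨f, hf, ?_, ?_⟩
    · rintro rfl
      simp at h0
    · rw [inForm_eq, maxWt_eq hw h0]

end Weights

section Lifting

variable {K : Type*} [Field K] {n k r : ℕ}

/-- The homogeneous elements of `in(M)` that are initial forms of homogeneous elements of `M`. -/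
def homogInForms (ω : Fin n → ℕ) (d ε : Fin k → ℕ) (M : Submodule (A K n) (Fin k → A K n)) :
    Set (Fin k → A K n) :=
  {g | ∃ f ∈ M, ∃ a, f ∈ wtSub 1 d {a} ∧ inForm ω ε f = g}

theorem homogInForms_subset (ω : Fin n → ℕ) (d ε : Fin k → ℕ)
    (M : Submodule (A K n) (Fin k → A K n)) : homogInForms ω d ε M ⊆ inMod ω ε M := by
  rintro _ ⟨f, hf, a, -, rfl⟩
  exact inForm_mem_inMod hf (mem_wtSub_maxWt ω ε f)

theorem span_homogInForms (ω : Fin n → ℕ) (d ε : Fin k → ℕ)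
    {M : Submodule (A K n) (Fin k → A K n)} (hM : IsGradedSub d M) :
    Submodule.span (A K n) (homogInForms ω d ε M) = inMod ω ε M := by
  refine le_antisymm (Submodule.span_le.2 (homogInForms_subset ω d ε M)) (Submodule.span_le.2 ?_)
  rintro _ ⟨f, hf, -, rfl⟩
  obtain ⟨N, hN⟩ := exists_sum_wtComp 1 d f
  rw [inForm_eq, ← hN, map_sum, hN]
  refine sum_mem fun a _ => ?_
  have hw : wtComp 1 d a f ∈ wtSub ω ε (Set.Iic (maxWt ω ε f)) :=
    wtComp_mem_wtSub a (mem_wtSub_maxWt ω ε f)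
  by_cases h0 : wtComp ω ε (maxWt ω ε f) (wtComp 1 d a f) = 0
  · rw [h0]; exact zero_mem _
  · refine Submodule.subset_span ⟨_, ?_, a, wtComp_mem 1 d a f, ?_⟩
    · rw [← homogComp_eq]; exact hM f hf a
    · rw [inForm_eq, maxWt_eq hw h0]

theorem exists_minimal_finset_span {R V : Type*} [Ring R] [AddCommGroup V] [Module R V]
    [IsNoetherian R V] (G : Set V) :
    ∃ T : Finset V, ↑T ⊆ G ∧ Submodule.span R (T : Set V) = Submodule.span R G ∧
      ∀ x ∈ T, x ∉ Submodule.span R ((T : Set V) \ {x}) := by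
  classical
  have hex : ∃ m, ∃ T : Finset V, T.card = m ∧ ↑T ⊆ G ∧
      Submodule.span R (T : Set V) = Submodule.span R G := by
    obtain ⟨T, hT, h⟩ := (Submodule.fg_span_iff_fg_span_finset_subset G).1
      (IsNoetherian.noetherian (Submodule.span R G))
    exact ⟨_, T, rfl, hT, h.symm⟩
  obtain ⟨T, hc, hTG, hT⟩ := Nat.find_spec hex
  refine ⟨T, hTG, hT, fun x hx hmem => ?_⟩
  refine Nat.find_min hex (m := (T.erase x).card) ?_ ⟨T.erase x, rfl, ?_, ?_⟩
  · rw [← hc]; exact Finset.card_erase_lt_of_mem hx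
  · exact (Finset.coe_subset.2 (Finset.erase_subset x T)).trans hTG
  · rw [← hT, Finset.coe_erase]
    refine le_antisymm (Submodule.span_mono Set.sdiff_subset) (Submodule.span_le.2 fun y hy => ?_)
    by_cases hyx : y = x
    · exact hyx ▸ hmem
    · exact Submodule.subset_span ⟨hy, hyx⟩

theorem ker_le_of_minimal {d : Fin k → ℕ} {d' : Fin r → ℕ}
    {φ : (Fin r → A K n) →ₗ[A K n] (Fin k → A K n)} (hφ : IsGradedMap 1 d' d φ)
    (hmin : ∀ l, φ (Pi.single l 1) ∉
      Submodule.span (A K n) ((fun m => φ (Pi.single m 1)) '' {l}ᶜ))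
    {s : Fin r → A K n} (hs : φ s = 0) (l : Fin r) : s l ∈ mIdeal K n := by
  by_contra hl
  replace hl : constantCoeff (s l) ≠ 0 := hl
  set t := wtComp 1 d' (d' l) s with ht
  have htl : t l = C (constantCoeff (s l)) := by
    ext u
    rw [ht, coeff_wtComp, coeff_C]
    simp only [Nat.add_eq_right, wdeg_one_eq_zero_iff]
    by_cases h : u = 0
    · simp [h, constantCoeff_eq]
    · simp [h, Ne.symm h]
  have h0 : φ t = 0 := by rw [ht, hφ.map_wtComp, hs, map_zero]
  have hsum : φ t = ∑ m, t m • φ (Pi.single m 1) := by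
    conv_lhs => rw [pi_eq_sum_univ' t]
    simp only [map_sum, map_smul]
  rw [hsum, ← Finset.add_sum_erase _ _ (Finset.mem_univ l), htl] at h0
  refine hmin l ?_
  have h1 : φ (Pi.single l 1) = (C (constantCoeff (s l))⁻¹ : A K n) •
      (-∑ m ∈ Finset.univ.erase l, t m • φ (Pi.single m 1)) := by
    rw [← eq_neg_of_add_eq_zero_left h0, smul_smul, ← C_mul, inv_mul_cancel₀ hl, C_1, one_smul]
  rw [h1]
  refine Submodule.smul_mem _ _ (neg_mem (sum_mem fun m hm => Submodule.smul_mem _ _ ?_))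
  exact Submodule.subset_span ⟨m, by simpa using hm, rfl⟩

section

variable {ω : Fin n → ℕ} {ε : Fin k → ℕ} {ε' : Fin r → ℕ}
  {M : Submodule (A K n) (Fin k → A K n)}
  {f g : (Fin r → A K n) →ₗ[A K n] (Fin k → A K n)}

theorem wtComp_map (hg : IsGradedMap ω ε' ε g)
    (hfg : ∀ l, (f - g) (Pi.single l 1) ∈ wtSub ω ε (Set.Iio (ε' l))) {w : ℕ}
    {s : Fin r → A K n} (hs : s ∈ wtSub ω ε' (Set.Iic w)) :
    wtComp ω ε w (f s) = g (wtComp ω ε' w s) ∧ f s ∈ wtSub ω ε (Set.Iic w) := by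
  have h1 : (f - g) s ∈ wtSub ω ε (Set.Iio w) :=
    map_mem_wtSub hfg (fun l a ha b hb => by
      simp only [Set.mem_Iio, Set.mem_Iic] at *; omega) hs
  have h2 : f s = g s + (f - g) s := by simp
  rw [h2]
  constructor
  · rw [map_add, hg.map_wtComp, wtComp_of_notMem (by simp) h1, add_zero]
  · exact add_mem (hg.map_mem hs) (wtSub_mono Set.Iio_subset_Iic_self h1)

theorem exists_preimage_of_lt (hg : IsGradedMap ω ε' ε g)
    (hfg : ∀ l, (f - g) (Pi.single l 1) ∈ wtSub ω ε (Set.Iio (ε' l)))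
    (hfM : LinearMap.range f ≤ M) (hgM : LinearMap.range g = inMod ω ε M) (w : ℕ) :
    ∀ h ∈ M, h ∈ wtSub ω ε (Set.Iio w) → ∃ s ∈ wtSub ω ε' (Set.Iio w), f s = h := by
  induction w with
  | zero =>
    intro h _ hw
    exact ⟨0, zero_mem _, by rw [eq_zero_of_mem_Iio_zero hw, map_zero]⟩
  | succ w ih =>
    intro h hM hw
    have hw' : h ∈ wtSub ω ε (Set.Iic w) := wtSub_mono (fun _ h => Nat.le_of_lt_succ h) hw
    obtain ⟨t, ht⟩ : wtComp ω ε w h ∈ LinearMap.range g := hgM ▸ inForm_mem_inMod hM hw'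
    set s := wtComp ω ε' w t with hs
    have hsw : s ∈ wtSub ω ε' {w} := wtComp_mem ω ε' w t
    have hs' : s ∈ wtSub ω ε' (Set.Iic w) := wtSub_mono (by simp) hsw
    obtain ⟨h1, h2⟩ := wtComp_map hg hfg hs'
    have h3 : wtComp ω ε w (h - f s) = 0 := by
      rw [map_sub, h1, wtComp_of_mem hsw, hs, hg.map_wtComp, ht,
        wtComp_of_mem (wtComp_mem ω ε w h), sub_self]
    have h4 := sub_wtComp_mem w (sub_mem hw' h2)
    rw [h3, sub_zero] at h4
    obtain ⟨s', hs'w, hfs'⟩ := ih (h - f s) (sub_mem hM (hfM ⟨s, rfl⟩))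
      (wtSub_mono (fun x hx => lt_of_le_of_ne hx.1 hx.2) h4)
    refine ⟨s + s', add_mem (wtSub_mono ?_ hs') (wtSub_mono ?_ hs'w), ?_⟩
    · exact fun x hx => Nat.lt_succ_of_le hx
    · exact fun x hx => Nat.lt_succ_of_lt hx
    · rw [map_add, hfs', add_sub_cancel]

theorem range_eq_of_range_initial (hg : IsGradedMap ω ε' ε g)
    (hfg : ∀ l, (f - g) (Pi.single l 1) ∈ wtSub ω ε (Set.Iio (ε' l)))
    (hfM : LinearMap.range f ≤ M) (hgM : LinearMap.range g = inMod ω ε M) :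
    LinearMap.range f = M := by
  refine le_antisymm hfM fun h hh => ?_
  obtain ⟨s, -, hs⟩ := exists_preimage_of_lt hg hfg hfM hgM (maxWt ω ε h + 1) h hh
    (wtSub_mono (fun x hx => Nat.lt_succ_of_le hx) (mem_wtSub_maxWt ω ε h))
  exact ⟨s, hs⟩

theorem ker_eq_inMod_ker (hg : IsGradedMap ω ε' ε g)
    (hfg : ∀ l, (f - g) (Pi.single l 1) ∈ wtSub ω ε (Set.Iio (ε' l)))
    (hfM : LinearMap.range f ≤ M) (hgM : LinearMap.range g = inMod ω ε M) :
    LinearMap.ker g = inMod ω ε' (LinearMap.ker f) := by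
  apply le_antisymm
  · intro s hs
    obtain ⟨N, hN⟩ := exists_sum_wtComp ω ε' s
    rw [← hN]
    refine sum_mem fun w _ => ?_
    set t := wtComp ω ε' w s with ht
    have htw : t ∈ wtSub ω ε' {w} := wtComp_mem ω ε' w s
    have ht' : t ∈ wtSub ω ε' (Set.Iic w) := wtSub_mono (by simp) htw
    have hgt : g t = 0 := by rw [ht, hg.map_wtComp, LinearMap.mem_ker.1 hs, map_zero]
    obtain ⟨h1, h2⟩ := wtComp_map hg hfg ht'
    have h3 := sub_wtComp_mem w h2
    rw [h1, wtComp_of_mem htw, hgt, sub_zero] at h3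
    obtain ⟨t', ht'w, hft'⟩ := exists_preimage_of_lt hg hfg hfM hgM w (f t) (hfM ⟨t, rfl⟩)
      (wtSub_mono (fun x hx => lt_of_le_of_ne hx.1 hx.2) h3)
    have h4 : wtComp ω ε' w (t - t') = t := by
      rw [map_sub, wtComp_of_mem htw, wtComp_of_notMem (by simp) ht'w, sub_zero]
    rw [← h4]
    refine inForm_mem_inMod (by simp [hft']) (sub_mem ht' (wtSub_mono ?_ ht'w))
    exact Set.Iio_subset_Iic_self
  · refine Submodule.span_le.2 ?_
    rintro _ ⟨s, hs, -, rfl⟩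
    have h1 := (wtComp_map hg hfg (mem_wtSub_maxWt ω ε' s)).1
    rw [LinearMap.mem_ker.1 hs, map_zero] at h1
    exact h1.symm

end

theorem isGradedSub_ker {d : Fin k → ℕ} {d' : Fin r → ℕ}
    {f : (Fin r → A K n) →ₗ[A K n] (Fin k → A K n)} (hf : IsGradedMap 1 d' d f) :
    IsGradedSub d' (LinearMap.ker f) := by
  intro s hs a
  rw [homogComp_eq, LinearMap.mem_ker, hf.map_wtComp, LinearMap.mem_ker.1 hs, map_zero]

/-- Simultaneous graded free covers of `M` and `in(M)`, minimal for `in(M)`, whose syzygy modules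
are again a graded module and its initial module. -/
structure InitialCover (ω : Fin n → ℕ) (d ε : Fin k → ℕ)
    (M : Submodule (A K n) (Fin k → A K n)) where
  rk : ℕ
  sh : Fin rk → ℕ
  wt : Fin rk → ℕ
  map : (Fin rk → A K n) →ₗ[A K n] (Fin k → A K n)
  initMap : (Fin rk → A K n) →ₗ[A K n] (Fin k → A K n)
  map_graded : IsGradedMap 1 sh d map
  initMap_graded : IsGradedMap 1 sh d initMap
  range_map : LinearMap.range map = M
  range_initMap : LinearMap.range initMap = inMod ω ε M
  ker_initMap : LinearMap.ker initMap = inMod ω wt (LinearMap.ker map)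
  minimal : ∀ s ∈ LinearMap.ker initMap, ∀ l, s l ∈ mIdeal K n

theorem nonempty_initialCover (ω : Fin n → ℕ) (d ε : Fin k → ℕ)
    {M : Submodule (A K n) (Fin k → A K n)} (hM : IsGradedSub d M) :
    Nonempty (InitialCover ω d ε M) := by
  obtain ⟨T, hTG, hT, hmin⟩ := exists_minimal_finset_span (R := A K n) (homogInForms ω d ε M)
  rw [span_homogInForms ω d ε hM] at hT
  let e := T.equivFin
  choose ff hffM sh hsh hin using fun l => hTG (e.symm l).2
  let wt : Fin T.card → ℕ := fun l => maxWt ω ε (ff l)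
  let gg : Fin T.card → (Fin k → A K n) := fun l => (e.symm l).1
  let f := Fintype.linearCombination (A K n) ff
  let g := Fintype.linearCombination (A K n) gg
  have hf1 : ∀ l, f (Pi.single l 1) = ff l := fun l => by
    simp [f, Fintype.linearCombination_apply_single]
  have hg1 : ∀ l, g (Pi.single l 1) = gg l := fun l => by
    simp [g, Fintype.linearCombination_apply_single]
  have hgg : ∀ l, gg l = wtComp ω ε (wt l) (ff l) := fun l => (hin l).symm
  have hginj : Function.Injective gg := Subtype.val_injective.comp e.symm.injective
  have hggr : Set.range gg = T := by
    rw [show gg = Subtype.val ∘ e.symm from rfl, Set.range_comp, e.symm.range_eq_univ]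
    simp
  have hfgr : IsGradedMap 1 sh d f := fun l => by rw [hf1]; exact hsh l
  have hggr1 : IsGradedMap 1 sh d g := fun l => by
    rw [hg1, hgg]; exact wtComp_mem_wtSub _ (hsh l)
  have hg : IsGradedMap ω wt ε g := fun l => by
    rw [hg1, hgg]; exact wtComp_mem ω ε _ _
  have hfg : ∀ l, (f - g) (Pi.single l 1) ∈ wtSub ω ε (Set.Iio (wt l)) := fun l => by
    rw [LinearMap.sub_apply, hf1, hg1, hgg]
    exact wtSub_mono (fun x hx => lt_of_le_of_ne hx.1 hx.2)
      (sub_wtComp_mem _ (mem_wtSub_maxWt ω ε (ff l)))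
  have hfM : LinearMap.range f ≤ M := by
    rw [Fintype.range_linearCombination, Submodule.span_le]
    rintro _ ⟨l, rfl⟩
    exact hffM l
  have hgM : LinearMap.range g = inMod ω ε M := by
    rw [Fintype.range_linearCombination, hggr, hT]
  refine ⟨⟨T.card, sh, wt, f, g, hfgr, hggr1, range_eq_of_range_initial hg hfg hfM hgM, hgM,
    ker_eq_inMod_ker hg hfg hfM hgM, fun s hs => ker_le_of_minimal hggr1 (fun l => ?_) hs⟩⟩
  simp only [hg1]
  rw [Set.image_compl_eq_range_sdiff_image hginj, hggr, Set.image_singleton]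
  exact hmin _ (e.symm l).2

end Lifting

section Comparison

variable {K : Type*} [Field K] {n : ℕ}

theorem exists_lift {a b c : ℕ} (p : (Fin b → A K n) →ₗ[A K n] (Fin c → A K n))
    (q : (Fin a → A K n) →ₗ[A K n] (Fin c → A K n)) (C : Fin a → (Fin b → A K n) → Prop)
    (h : ∀ l, ∃ x, p x = q (Pi.single l 1) ∧ C l x) :
    ∃ φ : (Fin a → A K n) →ₗ[A K n] (Fin b → A K n),
      (∀ x, p (φ x) = q x) ∧ ∀ l, C l (φ (Pi.single l 1)) := by
  choose x hx hC using h
  have hφ : ∀ l, Fintype.linearCombination (A K n) x (Pi.single l 1) = x l := fun l => by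
    simp [Fintype.linearCombination_apply_single]
  refine ⟨Fintype.linearCombination (A K n) x, fun y => ?_, fun l => by rw [hφ]; exact hC l⟩
  conv_rhs => rw [pi_eq_sum_univ' y]
  simp only [Fintype.linearCombination_apply, map_sum, map_smul, hx]

theorem exists_lift_of_range_le {a b c : ℕ} {p : (Fin b → A K n) →ₗ[A K n] (Fin c → A K n)}
    {q : (Fin a → A K n) →ₗ[A K n] (Fin c → A K n)} (h : ∀ x, q x ∈ LinearMap.range p) :
    ∃ φ : (Fin a → A K n) →ₗ[A K n] (Fin b → A K n), ∀ x, p (φ x) = q x := by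
  obtain ⟨φ, hφ, -⟩ := exists_lift p q (fun _ _ => True)
    fun l => (h (Pi.single l 1)).imp fun x hx => ⟨hx, trivial⟩
  exact ⟨φ, hφ⟩

theorem exists_graded_lift {a b c : ℕ} {ω : Fin n → ℕ} {da : Fin a → ℕ} {db : Fin b → ℕ}
    {dc : Fin c → ℕ} {p : (Fin b → A K n) →ₗ[A K n] (Fin c → A K n)}
    {q : (Fin a → A K n) →ₗ[A K n] (Fin c → A K n)} (hp : IsGradedMap ω db dc p)
    (hq : IsGradedMap ω da dc q) (h : ∀ x, q x ∈ LinearMap.range p) :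
    ∃ φ : (Fin a → A K n) →ₗ[A K n] (Fin b → A K n),
      (∀ x, p (φ x) = q x) ∧ IsGradedMap ω da db φ := by
  refine exists_lift p q (fun l x => x ∈ wtSub ω db {da l}) fun l => ?_
  obtain ⟨x, hx⟩ := h (Pi.single l 1)
  refine ⟨wtComp ω db (da l) x, ?_, wtComp_mem ω db _ x⟩
  rw [hp.map_wtComp, hx, wtComp_of_mem (hq l)]

theorem map_mem_mIdeal {a b : ℕ} (φ : (Fin a → A K n) →ₗ[A K n] (Fin b → A K n))
    {x : Fin a → A K n} (hx : ∀ l, x l ∈ mIdeal K n) (m : Fin b) : φ x m ∈ mIdeal K n := by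
  rw [pi_eq_sum_univ' x]
  simp only [map_sum, map_smul, Finset.sum_apply, Pi.smul_apply, smul_eq_mul]
  exact sum_mem fun l _ => Ideal.mul_mem_right _ _ (hx l)

theorem constantCoeff_map {a b : ℕ} (φ : (Fin a → A K n) →ₗ[A K n] (Fin b → A K n))
    (x : Fin a → A K n) (m : Fin b) :
    constantCoeff (φ x m) =
      ∑ l, constantCoeff (x l) * constantCoeff (φ (Pi.single l 1) m) := by
  conv_lhs => rw [pi_eq_sum_univ' x]
  simp only [map_sum, map_smul, Finset.sum_apply, Pi.smul_apply, smul_eq_mul, map_mul]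

/-- If `α ∘ β` is the identity modulo the maximal ideal and `β` is graded, then the source of `β`
has in each degree at most as many basis elements as its target. -/
theorem card_filter_le_of_comp {a b : ℕ} {da : Fin a → ℕ} {db : Fin b → ℕ}
    {α : (Fin b → A K n) →ₗ[A K n] (Fin a → A K n)}
    {β : (Fin a → A K n) →ₗ[A K n] (Fin b → A K n)} (hβ : IsGradedMap 1 da db β)
    (h : ∀ x l, (α (β x) - x) l ∈ mIdeal K n) (j : ℕ) :
    (Finset.univ.filter fun l => da l = j).card ≤ (Finset.univ.filter fun l => db l = j).card := by
  rw [← Fintype.card_subtype, ← Fintype.card_subtype]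
  let B : Matrix {l // db l = j} {l // da l = j} K :=
    fun l m => constantCoeff (β (Pi.single m.1 1) l.1)
  let P : Matrix {l // da l = j} {l // db l = j} K :=
    fun m l => constantCoeff (α (Pi.single l.1 1) m.1)
  have hPB : P * B = 1 := by
    ext m m'
    have h1 : constantCoeff (α (β (Pi.single m'.1 1)) m.1) =
        constantCoeff ((Pi.single m'.1 1 : Fin a → A K n) m.1) := by
      rw [← sub_eq_zero, ← map_sub]
      exact h (Pi.single m'.1 1) m.1
    have h2 : constantCoeff ((Pi.single m'.1 1 : Fin a → A K n) m.1) =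
        (1 : Matrix {l // da l = j} {l // da l = j} K) m m' := by
      by_cases hm : m = m'
      · subst hm; simp
      · rw [Matrix.one_apply_ne hm, Pi.single_eq_of_ne (fun h => hm (Subtype.ext h)), map_zero]
    rw [← h2, ← h1, constantCoeff_map, Matrix.mul_apply]
    have h3 : ∀ l, db l ≠ j → constantCoeff (β (Pi.single m'.1 1) l) = 0 := by
      intro l hl
      by_contra h0
      rw [constantCoeff_eq] at h0
      have h4 := hβ m'.1 l 0 h0
      rw [(wdeg_one_eq_zero_iff 0).2 rfl, zero_add, m'.2] at h4
      exact hl h4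
    rw [← Finset.sum_subset (Finset.subset_univ (Finset.univ.filter fun l => db l = j))
      fun l _ hl => by rw [h3 l (by simpa using hl), zero_mul]]
    rw [← Finset.sum_subtype_eq_sum_filter]
    simp only [Finset.subtype_univ]
    exact Finset.sum_congr rfl fun l _ => mul_comm _ _
  calc Fintype.card {l // da l = j} = (P * B).rank := by rw [hPB, Matrix.rank_one]
    _ ≤ B.rank := Matrix.rank_mul_le_right P B
    _ ≤ Fintype.card {l // db l = j} := Matrix.rank_le_card_height B

variable {k : ℕ} {d : Fin k → ℕ} {M : Submodule (A K n) (Fin k → A K n)}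

theorem GFRes.exists_comparison (res1 : GFRes d M) (h1 : res1.Minimal) (res : GFRes d M) (i : ℕ) :
    ∃ (α : (Fin (res.rk i) → A K n) →ₗ[A K n] (Fin (res1.rk i) → A K n))
      (β : (Fin (res1.rk i) → A K n) →ₗ[A K n] (Fin (res.rk i) → A K n))
      (θ : (Fin (res1.rk i) → A K n) →ₗ[A K n] (Fin (res1.rk i) → A K n)),
      (∀ x ∈ LinearMap.range (res.diff i), α x ∈ LinearMap.range (res1.diff i)) ∧
      (∀ x ∈ LinearMap.range (res1.diff i), β x ∈ LinearMap.range (res.diff i)) ∧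
      IsGradedMap 1 (res1.sh i) (res.sh i) β ∧
      (∀ x l, θ x l ∈ mIdeal K n) ∧
      (∀ x ∈ LinearMap.range (res1.diff i), θ x = 0) ∧
      ∀ x, α (β x) - x - θ x ∈ LinearMap.range (res1.diff i) := by
  induction i with
  | zero =>
    obtain ⟨α, hα⟩ := exists_lift_of_range_le (p := res1.aug) (q := res.aug)
      fun x => (res.aug_range.trans res1.aug_range.symm).le ⟨x, rfl⟩
    obtain ⟨β, hβ, hβg⟩ := exists_graded_lift (p := res.aug) (q := res1.aug)
      (fun l => isHomog_iff.1 (res.aug_hom l)) (fun l => isHomog_iff.1 (res1.aug_hom l))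
      fun x => (res1.aug_range.trans res.aug_range.symm).le ⟨x, rfl⟩
    rw [res.ex0, res1.ex0]
    refine ⟨α, β, 0, fun x hx => ?_, fun x hx => ?_, hβg, fun x l => ?_, fun x _ => rfl,
      fun x => ?_⟩
    · rw [LinearMap.mem_ker, hα, LinearMap.mem_ker.1 hx]
    · rw [LinearMap.mem_ker, hβ, LinearMap.mem_ker.1 hx]
    · exact zero_mem _
    · rw [LinearMap.mem_ker, LinearMap.zero_apply, sub_zero, map_sub, hα, hβ, sub_self]
  | succ i ih =>
    obtain ⟨α, β, θ, hα, hβ, hβg, hθm, hθ, hαβ⟩ := ih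
    obtain ⟨α', hα'⟩ := exists_lift_of_range_le (p := res1.diff i) (q := α ∘ₗ res.diff i)
      fun x => hα _ ⟨x, rfl⟩
    obtain ⟨β', hβ', hβg'⟩ := exists_graded_lift (p := res.diff i) (q := β ∘ₗ res1.diff i)
      (fun l => isHomog_iff.1 (res.diff_hom i l))
      (fun l => hβg.map_mem (isHomog_iff.1 (res1.diff_hom i l))) fun x => hβ _ ⟨x, rfl⟩
    obtain ⟨h, hh⟩ := exists_lift_of_range_le (p := res1.diff i)
      (q := α ∘ₗ β - LinearMap.id - θ) hαβ
    simp only [LinearMap.comp_apply, LinearMap.sub_apply, LinearMap.id_apply] at hα' hβ' hh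
    rw [res.exs, res1.exs]
    refine ⟨α', β', h ∘ₗ res1.diff i, fun x hx => ?_, fun x hx => ?_, hβg', fun x l => ?_,
      fun x hx => ?_, fun x => ?_⟩
    · rw [LinearMap.mem_ker, hα', LinearMap.mem_ker.1 hx, map_zero]
    · rw [LinearMap.mem_ker, hβ', LinearMap.mem_ker.1 hx, map_zero]
    · exact map_mem_mIdeal h (h1 i x) l
    · rw [LinearMap.comp_apply, LinearMap.mem_ker.1 hx, map_zero]
    · rw [LinearMap.mem_ker, LinearMap.comp_apply, map_sub, map_sub, hα', hβ', hh,
        hθ _ ⟨x, rfl⟩, sub_zero, sub_self]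

theorem GFRes.betti_le_of_minimal (res1 : GFRes d M) (h1 : res1.Minimal) (res : GFRes d M)
    (i j : ℕ) : res1.betti i j ≤ res.betti i j := by
  obtain ⟨α, β, θ, -, -, hβg, hθm, -, hαβ⟩ := res1.exists_comparison h1 res i
  refine card_filter_le_of_comp hβg (α := α) (fun x l => ?_) j
  obtain ⟨y, hy⟩ := hαβ x
  have := add_mem (h1 i y l) (hθm x l)
  rwa [hy, Pi.sub_apply, sub_add_cancel] at this

end Comparison

section Resolution

variable {K : Type*} [Field K] {n : ℕ}

/-- A graded submodule of a weighted free graded module of finite rank. -/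
structure GradedPair (K : Type*) [Field K] (n : ℕ) where
  rk : ℕ
  sh : Fin rk → ℕ
  wt : Fin rk → ℕ
  mod : Submodule (A K n) (Fin rk → A K n)
  graded : IsGradedSub sh mod

namespace GradedPair

/-- A chosen simultaneous cover of a module and of its initial module. -/
noncomputable def cover (ω : Fin n → ℕ) (S : GradedPair K n) :
    InitialCover ω S.sh S.wt S.mod :=
  (nonempty_initialCover ω S.sh S.wt S.graded).some

/-- The syzygies of the chosen cover. -/
noncomputable def syz (ω : Fin n → ℕ) (S : GradedPair K n) : GradedPair K n where
  rk := (S.cover ω).rk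
  sh := (S.cover ω).sh
  wt := (S.cover ω).wt
  mod := LinearMap.ker (S.cover ω).map
  graded := isGradedSub_ker (S.cover ω).map_graded

/-- The iterated syzygies. -/
noncomputable def iterSyz (ω : Fin n → ℕ) (S : GradedPair K n) : ℕ → GradedPair K n
  | 0 => S
  | i + 1 => (iterSyz ω S i).syz ω

/-- The graded free resolution of a module lifting the minimal one of its initial module. -/
noncomputable def res (ω : Fin n → ℕ) (S : GradedPair K n) : GFRes S.sh S.mod where
  rk i := (S.iterSyz ω (i + 1)).rk
  sh i := (S.iterSyz ω (i + 1)).sh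
  aug := (S.cover ω).map
  diff i := ((S.iterSyz ω (i + 1)).cover ω).map
  aug_range := (S.cover ω).range_map
  aug_hom l := isHomog_iff.2 ((S.cover ω).map_graded l)
  diff_hom i l := isHomog_iff.2 (((S.iterSyz ω (i + 1)).cover ω).map_graded l)
  ex0 := ((S.iterSyz ω 1).cover ω).range_map
  exs i := ((S.iterSyz ω (i + 2)).cover ω).range_map

/-- A minimal graded free resolution of the initial module. -/
noncomputable def initRes (ω : Fin n → ℕ) (S : GradedPair K n) :
    GFRes S.sh (inMod ω S.wt S.mod) where
  rk i := (S.iterSyz ω (i + 1)).rk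
  sh i := (S.iterSyz ω (i + 1)).sh
  aug := (S.cover ω).initMap
  diff i := ((S.iterSyz ω (i + 1)).cover ω).initMap
  aug_range := (S.cover ω).range_initMap
  aug_hom l := isHomog_iff.2 ((S.cover ω).initMap_graded l)
  diff_hom i l := isHomog_iff.2 (((S.iterSyz ω (i + 1)).cover ω).initMap_graded l)
  ex0 := ((S.iterSyz ω 1).cover ω).range_initMap.trans (S.cover ω).ker_initMap.symm
  exs i := ((S.iterSyz ω (i + 2)).cover ω).range_initMap.trans
    ((S.iterSyz ω (i + 1)).cover ω).ker_initMap.symm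

theorem initRes_minimal (ω : Fin n → ℕ) (S : GradedPair K n) : (S.initRes ω).Minimal := by
  intro i x l
  refine ((S.iterSyz ω i).cover ω).minimal _ ?_ l
  rw [((S.iterSyz ω i).cover ω).ker_initMap]
  exact ((S.iterSyz ω (i + 1)).cover ω).range_initMap.le ⟨x, rfl⟩

end GradedPair

end Resolution

/-- For a graded submodule `M ⊆ F`, the graded Betti numbers of
`F/M` are bounded by those of `F/in_{(ω,ε)}(M)`; equivalently (the degree-0 row
being given by `F` on both sides), `β_{ij}(M) ≤ β_{ij}(in_{(ω,ε)}(M))` for all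
`i, j`, as read off from any minimal graded free resolutions. -/
theorem betti_le_betti_initial_module
    {K : Type*} [Field K] {n k : ℕ} (ω : Fin n → ℕ) (d ε : Fin k → ℕ)
    (M : Submodule (A K n) (Fin k → A K n)) (hM : IsGradedSub d M)
    (res1 : GFRes d M) (h1 : res1.Minimal)
    (res2 : GFRes d (inMod ω ε M)) (h2 : res2.Minimal)
    (i j : ℕ) :
    res1.betti i j ≤ res2.betti i j := by
  let S : GradedPair K n := ⟨k, d, ε, M, hM⟩
  exact (res1.betti_le_of_minimal h1 (S.res ω) i j).trans
    ((S.initRes ω).betti_le_of_minimal (S.initRes_minimal ω) res2 i j)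

end CregPaper
end

section
/- Let R be a Koszul standard graded K-algebra and M a finitely generated graded R-module. Then creg(M) = max{ reg(M_{⟨d⟩}) − d : β_{0d}(M) ≠ 0 }, i.e. the componentwise regularity is achieved on the components in which M has minimal generators. -/
/-!  Setup for statements about componentwise regularity over a standard graded
`K`-algebra `R` with grading `𝒜 : ℤ → Submodule K R`: graded modules, graded
free resolutions, Castelnuovo–Mumford regularity bounds, Koszulness and
componentwise notions. -/

namespace CregPaperG

variable {K : Type*} [Field K] {R : Type*} [CommRing R] [Algebra K R]

/-- `R` with grading `𝒜` is a standard graded `K`-algebra: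
nothing in negative degrees, `R_0 = K·1`, and `R` generated in degree `1`. -/
def IsStdGraded (𝒜 : ℤ → Submodule K R) : Prop :=
  (∀ i : ℤ, i < 0 → 𝒜 i = ⊥) ∧ 𝒜 0 = 1 ∧
    ∀ i : ℕ, 𝒜 ((i : ℤ) + 1) = 𝒜 1 * 𝒜 (i : ℤ)

/-- the homogeneous maximal ideal `m = ⊕_{i>0} 𝒜_i` of `R`. -/
def mIdealG (𝒜 : ℤ → Submodule K R) : Ideal R :=
  Ideal.span (⋃ i : {i : ℤ // i ≠ 0}, (𝒜 i.1 : Set R))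

/-- A graded free resolution `⋯ → R^{rk 1} → R^{rk 0} → N → 0` of a submodule
`N` of a graded `R`-module `(M, ℳ)`, with degree shifts `sh i` and all maps
graded of degree `0`. -/
structure GRes (𝒜 : ℤ → Submodule K R) {M : Type*} [AddCommGroup M] [Module R M]
    [Module K M] [IsScalarTower K R M] (ℳ : ℤ → Submodule K M) (N : Submodule R M) where
  rk : ℕ → ℕ
  sh : (i : ℕ) → Fin (rk i) → ℤ
  aug : (Fin (rk 0) → R) →ₗ[R] M
  diff : (i : ℕ) → ((Fin (rk (i+1)) → R) →ₗ[R] (Fin (rk i) → R))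
  aug_range : LinearMap.range aug = N
  aug_hom : ∀ l, aug (Pi.single l 1) ∈ ℳ (sh 0 l)
  diff_hom : ∀ i l v, diff i (Pi.single l 1) v ∈ 𝒜 (sh (i+1) l - sh i v)
  ex0 : LinearMap.range (diff 0) = LinearMap.ker aug
  exs : ∀ i, LinearMap.range (diff (i+1)) = LinearMap.ker (diff i)

/-- minimality: the entries of all differential matrices lie in `m`. -/
def GRes.Minimal {𝒜 : ℤ → Submodule K R} {M : Type*} [AddCommGroup M] [Module R M]
    [Module K M] [IsScalarTower K R M] {ℳ : ℤ → Submodule K M} {N : Submodule R M}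
    (res : GRes 𝒜 ℳ N) : Prop :=
  ∀ i x l, res.diff i x l ∈ mIdealG 𝒜

/-- `reg_R(N) ≤ r`: there is a minimal graded free resolution of `N` with all
shifts in homological degree `i` bounded by `i + r`. -/
def GRegLE (𝒜 : ℤ → Submodule K R) {M : Type*} [AddCommGroup M] [Module R M]
    [Module K M] [IsScalarTower K R M] (ℳ : ℤ → Submodule K M) (N : Submodule R M)
    (r : ℤ) : Prop :=
  ∃ res : GRes 𝒜 ℳ N, res.Minimal ∧ ∀ i l, res.sh i l ≤ (i : ℤ) + r

/-- `R` is Koszul: the residue field `K = R/m` has a linear minimal graded free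
resolution; equivalently, the maximal ideal `m` (as a graded submodule of `R`)
has a minimal graded free resolution with `i`-th shifts all equal to `i + 1`. -/
def Koszul (𝒜 : ℤ → Submodule K R) : Prop :=
  ∃ res : GRes 𝒜 𝒜 (mIdealG 𝒜), res.Minimal ∧ ∀ i l, res.sh i l = (i : ℤ) + 1

/-- `M_{⟨a⟩}`: the `R`-submodule generated by the degree-`a` component. -/
def gcomp {M : Type*} [AddCommGroup M] [Module R M] [Module K M]
    [IsScalarTower K R M] (ℳ : ℤ → Submodule K M) (a : ℤ) : Submodule R M :=
  Submodule.span R (ℳ a : Set M)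

/-- the degree-`a` component of the graded free module `⊕_v R(-s_v)`. -/
def freeGrade (𝒜 : ℤ → Submodule K R) {k : ℕ} (s : Fin k → ℤ) (a : ℤ) :
    Submodule K (Fin k → R) where
  carrier := {f | ∀ v, f v ∈ 𝒜 (a - s v)}
  add_mem' := by intro f g hf hg v; exact (𝒜 _).add_mem (hf v) (hg v)
  zero_mem' := by intro v; exact (𝒜 _).zero_mem
  smul_mem' := by intro c f hf v; exact (𝒜 _).smul_mem c (hf v)

/-- componentwise linearity of a submodule `N` of the graded free module
`⊕_v R(-s_v)`: for every `a`, the submodule generated by the degree-`a`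
elements of `N` is zero or has regularity `a`. -/
def GCompLinear (𝒜 : ℤ → Submodule K R) {k : ℕ} (s : Fin k → ℤ)
    (N : Submodule R (Fin k → R)) : Prop :=
  ∀ a : ℤ,
    Submodule.span R ((freeGrade 𝒜 s a : Set (Fin k → R)) ∩ N) = ⊥ ∨
    GRegLE 𝒜 (freeGrade 𝒜 s)
      (Submodule.span R ((freeGrade 𝒜 s a : Set (Fin k → R)) ∩ N)) a

end CregPaperG

namespace CregPaperG

section FreeModules

variable {K : Type*} [Field K] {R : Type*} [CommRing R] [Algebra K R]
variable (𝒜 : ℤ → Submodule K R) [GradedAlgebra 𝒜]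

/-- The degree-`d` component of an element of the graded free module `⊕_v R(-s_v)`. -/
def component {ι : Type*} (s : ι → ℤ) (d : ℤ) : (ι → R) →ₗ[K] (ι → R) :=
  LinearMap.pi fun v => GradedAlgebra.proj 𝒜 (d - s v) ∘ₗ LinearMap.proj v

@[simp]
lemma component_apply {ι : Type*} (s : ι → ℤ) (d : ℤ) (f : ι → R) (v : ι) :
    component 𝒜 s d f v = (DirectSum.decompose 𝒜 (f v) (d - s v) : R) := rfl

lemma component_component {ι : Type*} (s : ι → ℤ) (d : ℤ) (f : ι → R) :
    component 𝒜 s d (component 𝒜 s d f) = component 𝒜 s d f := by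
  ext v
  simp only [component_apply]
  exact DirectSum.decompose_of_mem_same 𝒜 (SetLike.coe_mem _)

/-- A linear map between graded free modules is graded of degree `0`. -/
def IsGradedMap {κ ι : Type*} (t : κ → ℤ) (s : ι → ℤ) (α : (κ → R) →ₗ[R] (ι → R)) : Prop :=
  ∀ d f, component 𝒜 s d (α f) = α (component 𝒜 t d f)

/-- A submodule of a graded free module is homogeneous. -/
def IsHomogeneousSub {ι : Type*} (s : ι → ℤ) (N : Submodule R (ι → R)) : Prop :=
  ∀ d, ∀ f ∈ N, component 𝒜 s d f ∈ N

variable {𝒜}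

lemma decompose_mul_of_mem {x y : R} {d e : ℤ} (hy : y ∈ 𝒜 e) :
    (DirectSum.decompose 𝒜 (x * y) d : R) = (DirectSum.decompose 𝒜 x (d - e) : R) * y := by
  have h := DirectSum.coe_decompose_mul_add_of_right_mem 𝒜 (i := d - e) (a := x) hy
  rwa [sub_add_cancel] at h

lemma decompose_sum_apply {ι : Type*} (S : Finset ι) (f : ι → R) (d : ℤ) :
    (DirectSum.decompose 𝒜 (∑ i ∈ S, f i) d : R) =
      ∑ i ∈ S, (DirectSum.decompose 𝒜 (f i) d : R) :=
  map_sum (GradedAlgebra.proj 𝒜 d) _ _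

lemma IsGradedMap.comp {κ ι J : Type*} {t : κ → ℤ} {s : ι → ℤ} {u : J → ℤ}
    {β : (ι → R) →ₗ[R] (J → R)} {α : (κ → R) →ₗ[R] (ι → R)}
    (hβ : IsGradedMap 𝒜 s u β) (hα : IsGradedMap 𝒜 t s α) : IsGradedMap 𝒜 t u (β ∘ₗ α) := by
  intro d f
  simp [hβ d, hα d]

lemma IsGradedMap.add {κ ι : Type*} {t : κ → ℤ} {s : ι → ℤ}
    {α β : (κ → R) →ₗ[R] (ι → R)}
    (hα : IsGradedMap 𝒜 t s α) (hβ : IsGradedMap 𝒜 t s β) : IsGradedMap 𝒜 t s (α + β) := by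
  intro d f
  rw [LinearMap.add_apply, map_add, hα d, hβ d, LinearMap.add_apply]

lemma isGradedMap_funLeft {κ ι : Type*} (s : ι → ℤ) (g : κ → ι) :
    IsGradedMap 𝒜 s (s ∘ g) (LinearMap.funLeft R R g) := fun _ _ => rfl

lemma IsGradedMap.isHomogeneousSub_comap {κ ι : Type*} {t : κ → ℤ} {s : ι → ℤ}
    {α : (κ → R) →ₗ[R] (ι → R)} (hα : IsGradedMap 𝒜 t s α) {N : Submodule R (ι → R)}
    (hN : IsHomogeneousSub 𝒜 s N) : IsHomogeneousSub 𝒜 t (N.comap α) := by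
  intro d f hf
  rw [Submodule.mem_comap, ← hα d]
  exact hN d _ hf

lemma IsGradedMap.isHomogeneousSub_ker {κ ι : Type*} {t : κ → ℤ} {s : ι → ℤ}
    {α : (κ → R) →ₗ[R] (ι → R)} (hα : IsGradedMap 𝒜 t s α) :
    IsHomogeneousSub 𝒜 t (LinearMap.ker α) :=
  hα.isHomogeneousSub_comap (N := ⊥) (by
    intro d f hf
    rw [(Submodule.mem_bot R).1 hf, map_zero]
    exact zero_mem _)

lemma IsGradedMap.isHomogeneousSub_range {κ ι : Type*} {t : κ → ℤ} {s : ι → ℤ}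
    {α : (κ → R) →ₗ[R] (ι → R)} (hα : IsGradedMap 𝒜 t s α) :
    IsHomogeneousSub 𝒜 s (LinearMap.range α) := by
  rintro d _ ⟨f, rfl⟩
  exact ⟨_, (hα d f).symm⟩

lemma linearMap_eq_sum {κ X : Type*} [Fintype κ] [DecidableEq κ] [AddCommGroup X] [Module R X]
    (α : (κ → R) →ₗ[R] X) (f : κ → R) : α f = ∑ l, f l • α (Pi.single l 1) := by
  conv_lhs => rw [pi_eq_sum_univ' f]
  rw [map_sum]
  refine Finset.sum_congr rfl fun l _ => ?_
  rw [map_smul]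

lemma isGradedMap_of_single {κ ι : Type*} [Fintype κ] [DecidableEq κ] {t : κ → ℤ} {s : ι → ℤ}
    {α : (κ → R) →ₗ[R] (ι → R)} (h : ∀ l v, α (Pi.single l 1) v ∈ 𝒜 (t l - s v)) :
    IsGradedMap 𝒜 t s α := by
  intro d f
  ext v
  rw [linearMap_eq_sum α f, linearMap_eq_sum α (component 𝒜 t d f)]
  simp only [component_apply, Finset.sum_apply, Pi.smul_apply, smul_eq_mul, decompose_sum_apply]
  refine Finset.sum_congr rfl fun l _ => ?_
  rw [decompose_mul_of_mem (h l v), sub_sub_sub_cancel_right]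

lemma component_single {ι : Type*} [DecidableEq ι] (s : ι → ℤ) (l : ι) :
    component 𝒜 s (s l) (Pi.single l 1) = Pi.single l 1 := by
  ext v
  rw [component_apply]
  rcases eq_or_ne v l with rfl | h
  · rw [Pi.single_eq_same, sub_self]
    exact DirectSum.decompose_of_mem_same 𝒜 SetLike.GradedOne.one_mem
  · simp [h]

lemma IsGradedMap.single_mem {κ ι : Type*} [DecidableEq κ] {t : κ → ℤ} {s : ι → ℤ}
    {α : (κ → R) →ₗ[R] (ι → R)} (hα : IsGradedMap 𝒜 t s α) (l : κ) (v : ι) :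
    α (Pi.single l 1) v ∈ 𝒜 (t l - s v) := by
  rw [← component_single (𝒜 := 𝒜) t l, ← hα]
  exact SetLike.coe_mem _

lemma exists_isGradedMap_single_eq {κ ι : Type*} [Fintype κ] [DecidableEq κ] {t : κ → ℤ}
    {s : ι → ℤ} (b : κ → ι → R) (hb : ∀ l, component 𝒜 s (t l) (b l) = b l) :
    ∃ α : (κ → R) →ₗ[R] (ι → R), IsGradedMap 𝒜 t s α ∧ ∀ l, α (Pi.single l 1) = b l := by
  have h : ∀ l, Fintype.linearCombination R b (Pi.single l 1) = b l := fun l => by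
    rw [Fintype.linearCombination_apply_single, one_smul]
  refine ⟨Fintype.linearCombination R b, isGradedMap_of_single fun l v => ?_, h⟩
  rw [h, ← hb]
  exact SetLike.coe_mem _

end FreeModules

section Syzygies

variable {K : Type*} [Field K] {R : Type*} [CommRing R] [Algebra K R]
/-- A submodule of a finite graded free module, with a bound on the degrees of its generators. -/
structure BoundedSub (R : Type*) [CommRing R] where
  index : Type
  [finite : Finite index]
  shift : index → ℤ
  carrier : Submodule R (index → R)
  bound : ℤ

variable (𝒜 : ℤ → Submodule K R) [GradedAlgebra 𝒜]

/-- `X.carrier` is covered by a graded free module with shifts at most `X.bound` whose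
syzygy, with the bound increased by one, satisfies `S`. -/
def HasCover (S : Set (BoundedSub R)) (X : BoundedSub R) : Prop :=
  ∃ (κ : Type) (_ : Finite κ) (t : κ → ℤ) (α : (κ → R) →ₗ[R] (X.index → R)),
    IsGradedMap 𝒜 t X.shift α ∧ LinearMap.range α = X.carrier ∧ (∀ l, t l ≤ X.bound) ∧
      (⟨κ, t, LinearMap.ker α, X.bound + 1⟩ : BoundedSub R) ∈ S

/-- `N` has a (not necessarily minimal) graded free resolution with `i`-th shifts at most
`i + r`, expressed coinductively. -/
def HasBoundedRes {ι : Type} [Finite ι] (s : ι → ℤ) (N : Submodule R (ι → R)) (r : ℤ) : Prop :=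
  ∃ S : Set (BoundedSub R), (∀ X ∈ S, HasCover 𝒜 S X) ∧ (⟨ι, s, N, r⟩ : BoundedSub R) ∈ S

variable {𝒜}

lemma HasBoundedRes.exists_cover {ι : Type} [Finite ι] {s : ι → ℤ} {N : Submodule R (ι → R)}
    {r : ℤ} (h : HasBoundedRes 𝒜 s N r) :
    ∃ (κ : Type) (_ : Finite κ) (t : κ → ℤ) (α : (κ → R) →ₗ[R] (ι → R)),
      IsGradedMap 𝒜 t s α ∧ LinearMap.range α = N ∧ (∀ l, t l ≤ r) ∧
        HasBoundedRes 𝒜 t (LinearMap.ker α) (r + 1) := by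
  obtain ⟨S, hS, hN⟩ := h
  obtain ⟨κ, hκ, t, α, h1, h2, h3, h4⟩ := hS _ hN
  exact ⟨κ, hκ, t, α, h1, h2, h3, S, hS, h4⟩

lemma HasBoundedRes.of_cover {ι κ : Type} [Finite ι] [Finite κ] {s : ι → ℤ} {t : κ → ℤ} {r : ℤ}
    (α : (κ → R) →ₗ[R] (ι → R)) (hα : IsGradedMap 𝒜 t s α) (ht : ∀ l, t l ≤ r)
    (h : HasBoundedRes 𝒜 t (LinearMap.ker α) (r + 1)) :
    HasBoundedRes 𝒜 s (LinearMap.range α) r := by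
  obtain ⟨S, hS, hN⟩ := h
  refine ⟨insert ⟨ι, s, LinearMap.range α, r⟩ S, ?_, Set.mem_insert _ _⟩
  rintro X (rfl | hX)
  · exact ⟨κ, inferInstance, t, α, hα, rfl, ht, Set.mem_insert_of_mem _ hN⟩
  · obtain ⟨κ', i', t', α', h1, h2, h3, h4⟩ := hS X hX
    exact ⟨κ', i', t', α', h1, h2, h3, Set.mem_insert_of_mem _ h4⟩

lemma HasBoundedRes.mono {ι : Type} [Finite ι] {s : ι → ℤ} {N : Submodule R (ι → R)}
    {r r' : ℤ} (h : HasBoundedRes 𝒜 s N r) (hr : r ≤ r') : HasBoundedRes 𝒜 s N r' := by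
  refine ⟨{X | ∃ r ≤ X.bound, letI := X.finite; HasBoundedRes 𝒜 X.shift X.carrier r}, ?_,
    ⟨r, hr, h⟩⟩
  rintro X ⟨r, hr, h⟩
  have := X.finite
  obtain ⟨κ, hκ, t, α, h1, h2, h3, h4⟩ := h.exists_cover
  exact ⟨κ, hκ, t, α, h1, h2, fun l => (h3 l).trans hr, r + 1, by simpa using hr, h4⟩

lemma HasBoundedRes.map {ι J : Type} [Finite ι] [Finite J] {s : ι → ℤ} {u : J → ℤ}
    {N : Submodule R (ι → R)} {r : ℤ} (h : HasBoundedRes 𝒜 s N r)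
    (φ : (ι → R) →ₗ[R] (J → R)) (hφ : IsGradedMap 𝒜 s u φ) (hinj : LinearMap.ker φ = ⊥) :
    HasBoundedRes 𝒜 u (N.map φ) r := by
  obtain ⟨κ, hκ, t, α, h1, h2, h3, h4⟩ := h.exists_cover
  rw [← h2, ← LinearMap.range_comp]
  refine .of_cover _ (hφ.comp h1) h3 ?_
  rwa [LinearMap.ker_comp_of_ker_eq_bot _ hinj]

lemma hasBoundedRes_bot {ι : Type} [Finite ι] (s : ι → ℤ) (r : ℤ) :
    HasBoundedRes 𝒜 s (⊥ : Submodule R (ι → R)) r := by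
  refine ⟨{X | X.carrier = ⊥}, ?_, rfl⟩
  intro X hX
  refine ⟨Empty, inferInstance, Empty.elim, 0, fun d f => by simp, ?_, fun l => l.elim, ?_⟩
  · rw [LinearMap.range_zero]
    exact hX.symm
  · exact Subsingleton.elim _ _

/-- The syzygies of a submodule of a graded module inherit the bounds of a resolution. -/
lemma GRes.hasBoundedRes {M : Type*} [AddCommGroup M] [Module R M] [Module K M]
    [IsScalarTower K R M] {ℳ : ℤ → Submodule K M} {N : Submodule R M} (res : GRes 𝒜 ℳ N)
    {r : ℤ} (h : ∀ i l, res.sh i l ≤ (i : ℤ) + r) :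
    HasBoundedRes 𝒜 (res.sh 0) (LinearMap.range (res.diff 0)) (r + 1) := by
  refine ⟨Set.range fun i : ℕ =>
    (⟨Fin (res.rk i), res.sh i, LinearMap.range (res.diff i), i + (r + 1)⟩ : BoundedSub R),
    ?_, ⟨0, by simp⟩⟩
  rintro _ ⟨i, rfl⟩
  refine ⟨Fin (res.rk (i + 1)), inferInstance, res.sh (i + 1), res.diff i,
    isGradedMap_of_single (res.diff_hom i), rfl, fun l => ?_, ⟨i + 1, ?_⟩⟩
  · have := h (i + 1) l
    push_cast at this
    dsimp only
    omega
  · simp only [res.exs i]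
    congr 1
    push_cast
    ring

/-- Horseshoe lemma for an extension cut out by a graded map `φ`. -/
lemma HasBoundedRes.horseshoe {ι J : Type} [Finite ι] [Finite J] {s : ι → ℤ} {u : J → ℤ}
    {r : ℤ} (φ : (ι → R) →ₗ[R] (J → R)) (hφ : IsGradedMap 𝒜 s u φ) {N : Submodule R (ι → R)}
    (hN : IsHomogeneousSub 𝒜 s N) (hker : HasBoundedRes 𝒜 s (N ⊓ LinearMap.ker φ) r)
    (hmap : HasBoundedRes 𝒜 u (N.map φ) r) : HasBoundedRes 𝒜 s N r := by
  classical
  refine ⟨{X | letI := X.finite; ∃ (J : Type) (_ : Finite J) (u : J → ℤ)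
    (φ : (X.index → R) →ₗ[R] (J → R)), IsGradedMap 𝒜 X.shift u φ ∧
    IsHomogeneousSub 𝒜 X.shift X.carrier ∧
    HasBoundedRes 𝒜 X.shift (X.carrier ⊓ LinearMap.ker φ) X.bound ∧
    HasBoundedRes 𝒜 u (X.carrier.map φ) X.bound}, ?_,
    ⟨J, inferInstance, u, φ, hφ, hN, hker, hmap⟩⟩
  rintro ⟨ι, s, N, r⟩ ⟨J, _, u, φ, hφ, hN, hker, hmap⟩
  dsimp only at hφ hN hker hmap ⊢
  obtain ⟨κ, _, t, α, hα, hαr, ht, hαk⟩ := hker.exists_cover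
  obtain ⟨μ, _, w, ψ, hψ, hψr, hw, hψk⟩ := hmap.exists_cover
  have := Fintype.ofFinite μ
  have hlift : ∀ l : μ, ∃ b ∈ N, component 𝒜 s (w l) b = b ∧ φ b = ψ (Pi.single l 1) := by
    intro l
    have hm : ψ (Pi.single l 1) ∈ N.map φ := hψr ▸ LinearMap.mem_range_self _ _
    obtain ⟨b, hb, hφb⟩ := hm
    refine ⟨_, hN (w l) b hb, component_component 𝒜 _ _ _, ?_⟩
    rw [← hφ, hφb, hψ, component_single]
  choose b hbN hbc hbφ using hlift
  obtain ⟨L, hL, hLb⟩ := exists_isGradedMap_single_eq (𝒜 := 𝒜) (t := w) (s := s) b hbc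
  have hLN : ∀ f, L f ∈ N := fun f => by
    rw [linearMap_eq_sum L f]
    exact Submodule.sum_mem _ fun l _ => N.smul_mem _ (hLb l ▸ hbN l)
  have hφL : ∀ f, φ (L f) = ψ f := fun f => by
    rw [linearMap_eq_sum ψ f, linearMap_eq_sum L f, map_sum]
    exact Finset.sum_congr rfl fun l _ => by rw [map_smul, hLb, hbφ]
  have hαN : ∀ f, α f ∈ N ∧ φ (α f) = 0 := fun f => by
    have : α f ∈ N ⊓ LinearMap.ker φ := hαr ▸ LinearMap.mem_range_self _ _
    exact this
  have hsurj : ∀ x ∈ N, φ x = 0 → ∃ a, α a = x := fun x hx hx0 => by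
    have : x ∈ LinearMap.range α := hαr ▸ ⟨hx, hx0⟩
    exact this
  let θ : (κ ⊕ μ → R) →ₗ[R] (ι → R) :=
    α ∘ₗ LinearMap.funLeft R R Sum.inl + L ∘ₗ LinearMap.funLeft R R Sum.inr
  have hθ : ∀ f, θ f = α (f ∘ Sum.inl) + L (f ∘ Sum.inr) := fun f => rfl
  have hθg : IsGradedMap 𝒜 (Sum.elim t w) s θ :=
    (hα.comp (isGradedMap_funLeft (Sum.elim t w) Sum.inl)).add
      (hL.comp (isGradedMap_funLeft (Sum.elim t w) Sum.inr))
  let inl : (κ → R) →ₗ[R] (κ ⊕ μ → R) :=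
    { toFun := fun f => Sum.elim f 0
      map_add' := fun f g => by ext (x | x) <;> simp
      map_smul' := fun c f => by ext (x | x) <;> simp }
  have hinl : IsGradedMap 𝒜 t (Sum.elim t w) inl := by
    intro d f
    ext (x | x) <;> simp [inl]
  have hinl_ker : LinearMap.ker inl = ⊥ := by
    rw [LinearMap.ker_eq_bot]
    intro f g h
    ext x
    exact congrFun h (Sum.inl x)
  refine ⟨κ ⊕ μ, inferInstance, Sum.elim t w, θ, hθg, ?_, ?_, ?_⟩
  · apply le_antisymm
    · rintro _ ⟨f, rfl⟩
      exact N.add_mem (hαN _).1 (hLN _)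
    · intro x hx
      have hm : φ x ∈ LinearMap.range ψ := hψr ▸ Submodule.mem_map_of_mem hx
      obtain ⟨c, hc⟩ := hm
      obtain ⟨a, ha⟩ := hsurj (x - L c) (N.sub_mem hx (hLN c)) (by rw [map_sub, hφL, hc, sub_self])
      refine ⟨Sum.elim a c, ?_⟩
      rw [hθ, Sum.elim_comp_inl, Sum.elim_comp_inr, ha, sub_add_cancel]
  · rintro (l | l)
    · exact ht l
    · exact hw l
  · refine ⟨μ, inferInstance, w, LinearMap.funLeft R R Sum.inr,
      isGradedMap_funLeft (Sum.elim t w) Sum.inr, hθg.isHomogeneousSub_ker, ?_, ?_⟩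
    · convert hαk.map inl hinl hinl_ker using 1
      ext f
      simp only [Submodule.mem_inf, LinearMap.mem_ker, Submodule.mem_map, hθ]
      constructor
      · rintro ⟨h1, h2⟩
        have h2 : f ∘ Sum.inr = 0 := h2
        rw [h2, map_zero, add_zero] at h1
        refine ⟨f ∘ Sum.inl, h1, ?_⟩
        ext (x | x)
        · rfl
        · exact (congrFun h2 x).symm
      · rintro ⟨a, ha, rfl⟩
        change α (Sum.elim a 0 ∘ Sum.inl) + L (Sum.elim a 0 ∘ Sum.inr) = 0 ∧
          Sum.elim a 0 ∘ Sum.inr = 0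
        simp [ha]
    · convert hψk using 1
      ext c
      simp only [LinearMap.mem_ker, Submodule.mem_map, hθ]
      constructor
      · rintro ⟨f, hf, rfl⟩
        have := congrArg φ hf
        rw [map_add, (hαN _).2, hφL, zero_add, map_zero] at this
        exact this
      · intro hc
        obtain ⟨a, ha⟩ := hsurj (L c) (hLN c) (by rw [hφL, hc])
        refine ⟨Sum.elim (-a) c, ?_, rfl⟩
        simp [ha]

/-- Finite direct sums of twists `⊕_l N(-t_l)`. -/
lemma HasBoundedRes.pi {J ι : Type} [Finite J] [Finite ι] {s : ι → ℤ}
    {N : Submodule R (ι → R)} {r : ℤ} (h : HasBoundedRes 𝒜 s N r) {t : J → ℤ} {e : ℤ}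
    (ht : ∀ l, t l ≤ e) :
    HasBoundedRes 𝒜 (fun p : J × ι => t p.1 + s p.2)
      (⨅ l : J, N.comap (LinearMap.funLeft R R (Prod.mk l))) (r + e) := by
  refine ⟨{X | ∃ (ι : Type) (_ : Finite ι) (s : ι → ℤ) (N : Submodule R (ι → R)) (r : ℤ),
    HasBoundedRes 𝒜 s N r ∧ X = ⟨J × ι, fun p => t p.1 + s p.2,
      ⨅ l : J, N.comap (LinearMap.funLeft R R (Prod.mk l)), r + e⟩}, ?_,
    ⟨ι, inferInstance, s, N, r, h, rfl⟩⟩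
  rintro _ ⟨ι, _, s, N, r, h, rfl⟩
  obtain ⟨κ, _, w, α, hα, hαr, hw, hαk⟩ := h.exists_cover
  let A : (J × κ → R) →ₗ[R] (J × ι → R) := LinearMap.pi fun p =>
    LinearMap.proj p.2 ∘ₗ α ∘ₗ LinearMap.funLeft R R (Prod.mk p.1)
  have hA : ∀ f l, A f ∘ Prod.mk l = α (f ∘ Prod.mk l) := fun f l => rfl
  refine ⟨J × κ, inferInstance, fun p => t p.1 + w p.2, A, ?_, ?_, ?_, κ, inferInstance, w, _,
    r + 1, hαk, ?_⟩
  · intro d f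
    ext ⟨l, i⟩
    have h1 := congrFun (hα (d - t l) (f ∘ Prod.mk l)) i
    have h2 : component 𝒜 w (d - t l) (f ∘ Prod.mk l) =
        component 𝒜 (fun p : J × κ => t p.1 + w p.2) d f ∘ Prod.mk l := by
      ext k
      rw [component_apply, Function.comp_apply, Function.comp_apply, component_apply, sub_sub]
    rw [h2, ← hA] at h1
    rw [component_apply, sub_sub] at h1
    exact h1
  · ext g
    simp only [Submodule.mem_iInf, Submodule.mem_comap]
    constructor
    · rintro ⟨f, rfl⟩ l
      rw [← hαr]
      exact ⟨f ∘ Prod.mk l, rfl⟩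
    · intro hg
      have : ∀ l, ∃ f, α f = g ∘ Prod.mk l := fun l => by
        have := hg l
        rw [← hαr] at this
        exact this
      choose f hf using this
      refine ⟨fun p => f p.1 p.2, ?_⟩
      ext ⟨l, i⟩
      exact congrFun (hf l) i
  · rintro ⟨l, k⟩
    have := ht l
    have := hw k
    dsimp only
    omega
  · congr 1
    · ext f
      simp only [Submodule.mem_iInf, Submodule.mem_comap, LinearMap.mem_ker]
      constructor
      · intro hf l
        change α (f ∘ Prod.mk l) = 0
        rw [← hA, hf]
        rfl
      · intro hf
        ext ⟨l, i⟩
        exact congrFun (hf l) i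
    · ring

end Syzygies

section Minimization

variable {K : Type*} [Field K] {R : Type*} [CommRing R] [Algebra K R]
variable {𝒜 : ℤ → Submodule K R} [GradedAlgebra 𝒜]

lemma exists_decompose_zero_eq_algebraMap (h0 : 𝒜 0 = 1) {x : R} (hx : x ∉ mIdealG 𝒜) :
    ∃ k : K, k ≠ 0 ∧ (DirectSum.decompose 𝒜 x 0 : R) = algebraMap K R k := by
  classical
  have hmem : (DirectSum.decompose 𝒜 x 0 : R) ∈ (1 : Submodule K R) := h0 ▸ SetLike.coe_mem _
  obtain ⟨k, hk⟩ := Submodule.mem_one.1 hmem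
  refine ⟨k, ?_, hk.symm⟩
  rintro rfl
  apply hx
  rw [← DirectSum.sum_support_decompose 𝒜 x]
  refine Ideal.sum_mem _ fun i _ => ?_
  rcases eq_or_ne i 0 with rfl | hi
  · rw [← hk, map_zero]
    exact zero_mem _
  · exact Ideal.subset_span (Set.mem_iUnion.2 ⟨⟨i, hi⟩, SetLike.coe_mem _⟩)

/-- A syzygy with a unit coordinate allows one to drop the corresponding generator. -/
lemma exists_smaller_cover {X : Type*} [AddCommGroup X] [Module R X] {ι : Type} [Finite ι]
    {s : ι → ℤ} {r : ℤ} (α : (ι → R) →ₗ[R] X)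
    (hr : ∀ l, s l ≤ r) (hres : HasBoundedRes 𝒜 s (LinearMap.ker α) (r + 1))
    {j : ι} {z : ι → R} (hz : α z = 0) (hzc : component 𝒜 s (s j) z = z) (hzj : z j = 1) :
    ∃ inc : ({i // i ≠ j} → R) →ₗ[R] (ι → R),
      IsGradedMap 𝒜 (fun i : {i // i ≠ j} => s i) s inc ∧
      LinearMap.range (α ∘ₗ inc) = LinearMap.range α ∧
      HasBoundedRes 𝒜 (fun i : {i // i ≠ j} => s i) (LinearMap.ker (α ∘ₗ inc)) (r + 1) := by
  classical
  let inc : ({i // i ≠ j} → R) →ₗ[R] (ι → R) :=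
    { toFun := fun f i => if h : i ≠ j then f ⟨i, h⟩ else 0
      map_add' := fun f g => by ext i; by_cases h : i = j <;> simp [h]
      map_smul' := fun c f => by ext i; by_cases h : i = j <;> simp [h] }
  have inc_ne : ∀ f i (h : i ≠ j), inc f i = f ⟨i, h⟩ := fun f i h => dif_pos h
  have inc_self : ∀ f, inc f j = 0 := fun f => dif_neg (by simp)
  let ρ : (ι → R) →ₗ[R] ({i // i ≠ j} → R) :=
    LinearMap.funLeft R R Subtype.val -
      (LinearMap.proj j : (ι → R) →ₗ[R] R).smulRight (fun i : {i // i ≠ j} => z i)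
  have hρ : ∀ f i, ρ f i = f i - f j * z i := fun f i => rfl
  have hincρ : ∀ f, inc (ρ f) = f - f j • z := fun f => by
    ext i
    rcases eq_or_ne i j with rfl | h
    · simp [inc_self, hzj]
    · rw [inc_ne _ _ h, hρ]; rfl
  have hρinc : ∀ f, ρ (inc f) = f := fun f => by
    ext i
    rw [hρ, inc_self, zero_mul, sub_zero, inc_ne _ _ i.2]
  have hαρ : ∀ f, α (inc (ρ f)) = α f := fun f => by
    rw [hincρ, map_sub, map_smul, hz, smul_zero, sub_zero]
  have hzmem : ∀ i, z i ∈ 𝒜 (s j - s i) := fun i => by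
    rw [← hzc]
    exact SetLike.coe_mem _
  have hinc : IsGradedMap 𝒜 (fun i : {i // i ≠ j} => s i) s inc := by
    intro d f
    ext i
    rw [component_apply]
    rcases eq_or_ne i j with rfl | h
    · simp [inc_self]
    · rw [inc_ne _ _ h, inc_ne _ _ h]; rfl
  have hρg : IsGradedMap 𝒜 s (fun i : {i // i ≠ j} => s i) ρ := by
    intro d f
    ext i
    rw [component_apply, hρ, hρ, component_apply, component_apply, DirectSum.decompose_sub,
      DirectSum.sub_apply, AddSubgroupClass.coe_sub, decompose_mul_of_mem (hzmem i),
      sub_sub_sub_cancel_right]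
  refine ⟨inc, hinc, ?_, ?_⟩
  · apply le_antisymm (LinearMap.range_comp_le_range _ _)
    rintro _ ⟨f, rfl⟩
    exact ⟨ρ f, hαρ f⟩
  obtain ⟨κ, _, t, β, hβ, hβr, ht, hβk⟩ := hres.exists_cover
  have hβα : ∀ f, α (β f) = 0 := fun f => by
    have : β f ∈ LinearMap.ker α := hβr ▸ LinearMap.mem_range_self _ _
    exact this
  have hsurj : ∀ x, α x = 0 → ∃ a, β a = x := fun x hx => by
    have : x ∈ LinearMap.range β := hβr ▸ hx
    exact this
  have hrange : LinearMap.range (ρ ∘ₗ β) = LinearMap.ker (α ∘ₗ inc) := by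
    ext f
    constructor
    · rintro ⟨g, rfl⟩
      change α (inc (ρ (β g))) = 0
      rw [hαρ, hβα]
    · intro hf
      obtain ⟨g, hg⟩ := hsurj (inc f) hf
      exact ⟨g, by rw [LinearMap.comp_apply, hg, hρinc]⟩
  rw [← hrange]
  refine .of_cover _ (hρg.comp hβ) ht ?_
  refine .horseshoe β hβ (hρg.comp hβ).isHomogeneousSub_ker ?_ ?_
  · rwa [inf_eq_right.2 (LinearMap.ker_le_ker_comp _ _)]
  · let ζ : (Unit → R) →ₗ[R] (ι → R) := (LinearMap.proj () : (Unit → R) →ₗ[R] R).smulRight z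
    have hζ : ∀ f, ζ f = f () • z := fun f => rfl
    have hζr : (LinearMap.ker (ρ ∘ₗ β)).map β = LinearMap.range ζ := by
      ext f
      constructor
      · rintro ⟨g, hg, rfl⟩
        have hg : ρ (β g) = 0 := hg
        have := hincρ (β g)
        rw [hg, map_zero] at this
        exact ⟨fun _ => β g j, (sub_eq_zero.1 this.symm).symm⟩
      · rintro ⟨c, rfl⟩
        obtain ⟨g, hg⟩ := hsurj (ζ c) (by rw [hζ, map_smul, hz, smul_zero])
        refine ⟨g, ?_, hg⟩
        change ρ (β g) = 0
        rw [hg]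
        ext i
        simp [hρ, hζ, hzj]
    have hζk : LinearMap.ker ζ = ⊥ := by
      rw [LinearMap.ker_eq_bot']
      intro c hc
      ext
      have := congrFun hc j
      simpa [hζ, hzj] using this
    have hζg : IsGradedMap 𝒜 (fun _ : Unit => s j) s ζ := by
      intro d f
      ext i
      simp only [component_apply, hζ, Pi.smul_apply, smul_eq_mul]
      rw [decompose_mul_of_mem (hzmem i), sub_sub_sub_cancel_right]
    rw [hζr]
    refine .of_cover ζ hζg (fun _ => (hr j).trans (by omega)) ?_
    rw [hζk]
    exact hasBoundedRes_bot _ _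

/-- A graded cover with a bounded resolution restricts to a minimal cover. -/
lemma exists_minimal_cover (h0 : 𝒜 0 = 1) {X : Type*} [AddCommGroup X] [Module R X] {r : ℤ}
    (n : ℕ) : ∀ {ι : Type} [Finite ι] {s : ι → ℤ} (α : (ι → R) →ₗ[R] X), Nat.card ι = n →
    IsHomogeneousSub 𝒜 s (LinearMap.ker α) →
    (∀ l, s l ≤ r) → HasBoundedRes 𝒜 s (LinearMap.ker α) (r + 1) →
    ∃ (k : ℕ) (t : Fin k → ℤ) (inc : (Fin k → R) →ₗ[R] (ι → R)),
      IsGradedMap 𝒜 t s inc ∧ LinearMap.range (α ∘ₗ inc) = LinearMap.range α ∧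
      (∀ f ∈ LinearMap.ker (α ∘ₗ inc), ∀ l, f l ∈ mIdealG 𝒜) ∧ (∀ l, t l ≤ r) ∧
      HasBoundedRes 𝒜 t (LinearMap.ker (α ∘ₗ inc)) (r + 1) := by
  induction n with
  | zero =>
    intro ι _ s α hn _ hr hres
    have : IsEmpty ι := (Nat.card_eq_zero.1 hn).resolve_right (by simpa using ‹Finite ι›)
    refine ⟨0, Fin.elim0, 0, fun d f => by simp, ?_, fun f _ l => l.elim0, fun l => l.elim0, ?_⟩
    · have hα0 : α = 0 := LinearMap.ext fun f => by rw [Subsingleton.elim f 0, map_zero, map_zero]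
      rw [hα0, LinearMap.zero_comp, LinearMap.range_zero, LinearMap.range_zero]
    · rw [Subsingleton.elim (LinearMap.ker _) ⊥]
      exact hasBoundedRes_bot _ _
  | succ n ih =>
    intro ι _ s α hn hhom hr hres
    by_cases hmin : ∀ f ∈ LinearMap.ker α, ∀ l, f l ∈ mIdealG 𝒜
    · let e : Fin (n + 1) ≃ ι := (Finite.equivFinOfCardEq hn).symm
      have hinc : IsGradedMap 𝒜 (s ∘ e) s (LinearMap.funLeft R R e.symm) := by
        convert isGradedMap_funLeft (𝒜 := 𝒜) (s ∘ e) e.symm using 1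
        ext i
        simp
      have hcomp : LinearMap.ker (α ∘ₗ LinearMap.funLeft R R e.symm) =
          (LinearMap.ker α).map (LinearMap.funLeft R R e) := by
        ext f
        constructor
        · intro hf
          exact ⟨f ∘ e.symm, hf, by ext i; simp [LinearMap.funLeft_apply]⟩
        · rintro ⟨g, hg, rfl⟩
          have : (g ∘ e) ∘ e.symm = g := by ext i; simp
          change α ((g ∘ e) ∘ e.symm) = 0
          rw [this]
          exact hg
      refine ⟨n + 1, s ∘ e, LinearMap.funLeft R R e.symm, hinc, ?_, ?_, fun l => hr _, ?_⟩
      · rw [LinearMap.range_comp_of_range_eq_top]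
        exact LinearMap.range_eq_top.2 (LinearMap.funLeft_surjective_of_injective _ _ _
          e.symm.injective)
      · intro f hf l
        have := hmin (f ∘ e.symm) hf (e l)
        simpa using this
      · rw [hcomp]
        exact hres.map _ (isGradedMap_funLeft s e) (LinearMap.ker_eq_bot.2
          (LinearMap.funLeft_injective_of_surjective _ _ _ e.surjective))
    · push Not at hmin
      obtain ⟨x, hx, j, hxj⟩ := hmin
      obtain ⟨k, hk, hxk⟩ := exists_decompose_zero_eq_algebraMap h0 hxj
      have hzj : (k⁻¹ • component 𝒜 s (s j) x) j = 1 := by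
        rw [Pi.smul_apply, component_apply, sub_self, hxk, Algebra.smul_def, ← map_mul,
          inv_mul_cancel₀ hk, map_one]
      have hz : α (k⁻¹ • component 𝒜 s (s j) x) = 0 := by
        rw [← algebraMap_smul R, map_smul]
        rw [show α (component 𝒜 s (s j) x) = 0 from hhom _ x hx, smul_zero]
      obtain ⟨inc, hinc, hincr, hinck⟩ := exists_smaller_cover α hr hres hz
        (by rw [map_smul, component_component]) hzj
      have hcard : Nat.card {i // i ≠ j} = n := by
        classical
        have := Fintype.ofFinite ι
        rw [Nat.card_eq_fintype_card] at hn ⊢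
        rw [Fintype.card_subtype_compl, Fintype.card_subtype_eq, hn, Nat.add_sub_cancel]
      obtain ⟨k, t, inc', h1, h2, h3, h4, h5⟩ := ih (α ∘ₗ inc) hcard
        (by rw [LinearMap.ker_comp]; exact hinc.isHomogeneousSub_comap hhom)
        (fun l => hr l) hinck
      exact ⟨k, t, inc ∘ₗ inc', hinc.comp h1, h2.trans hincr, h3, h4, h5⟩

/-- A syzygy module sitting inside the maximal ideal times a graded free module. -/
structure MinimalSyzygy (𝒜 : ℤ → Submodule K R) [GradedAlgebra 𝒜] where
  rk : ℕ
  shift : Fin rk → ℤ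
  carrier : Submodule R (Fin rk → R)
  bound : ℤ
  minimal : ∀ f ∈ carrier, ∀ l, f l ∈ mIdealG 𝒜
  res : HasBoundedRes 𝒜 shift carrier bound

lemma MinimalSyzygy.exists_next (h0 : 𝒜 0 = 1) (Z : MinimalSyzygy 𝒜) :
    ∃ (Z' : MinimalSyzygy 𝒜) (δ : (Fin Z'.rk → R) →ₗ[R] (Fin Z.rk → R)),
      IsGradedMap 𝒜 Z'.shift Z.shift δ ∧ LinearMap.range δ = Z.carrier ∧
      LinearMap.ker δ = Z'.carrier ∧ (∀ l, Z'.shift l ≤ Z.bound) ∧ Z'.bound = Z.bound + 1 := by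
  obtain ⟨κ, _, t, α, hα, hαr, ht, hαk⟩ := Z.res.exists_cover
  obtain ⟨k, t', inc, h1, h2, h3, h4, h5⟩ := exists_minimal_cover h0 _ α rfl
    hα.isHomogeneousSub_ker ht hαk
  exact ⟨⟨k, t', _, _, h3, h5⟩, α ∘ₗ inc, hα.comp h1, h2.trans hαr, rfl, h4, rfl⟩

/-- A graded cover by a free module with a bounded resolution of its kernel bounds the
regularity. -/
lemma gRegLE_of_cover (h0 : 𝒜 0 = 1) {M : Type*} [AddCommGroup M] [Module R M] [Module K M]
    [IsScalarTower K R M] {ℳ : ℤ → Submodule K M} {r : ℤ} {ι : Type} [Finite ι] {s : ι → ℤ}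
    (α : (ι → R) →ₗ[R] M) (hα : ∀ d f, component 𝒜 s d f = f → α f ∈ ℳ d)
    (hhom : IsHomogeneousSub 𝒜 s (LinearMap.ker α)) (hs : ∀ l, s l ≤ r)
    (hres : HasBoundedRes 𝒜 s (LinearMap.ker α) (r + 1)) :
    GRegLE 𝒜 ℳ (LinearMap.range α) r := by
  obtain ⟨k, t, inc, h1, h2, h3, h4, h5⟩ := exists_minimal_cover h0 _ α rfl hhom hs hres
  choose next δ hδ using MinimalSyzygy.exists_next (𝒜 := 𝒜) h0
  let Z : ℕ → MinimalSyzygy 𝒜 := fun i => Nat.rec ⟨k, t, _, _, h3, h5⟩ (fun _ => next) i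
  have hbound : ∀ i, (Z i).bound = i + (r + 1) := by
    intro i
    induction i with
    | zero => simp [Z]
    | succ i ih =>
      change (next (Z i)).bound = _
      rw [(hδ _).2.2.2.2, ih]
      push_cast
      ring
  refine ⟨
    { rk := fun i => (Z i).rk
      sh := fun i => (Z i).shift
      aug := α ∘ₗ inc
      diff := fun i => δ (Z i)
      aug_range := h2
      aug_hom := fun l => hα _ _ ((h1 _ _).trans (congrArg inc (component_single t l)))
      diff_hom := fun i => (hδ (Z i)).1.single_mem
      ex0 := (hδ (Z 0)).2.1
      exs := fun i => (hδ (Z (i + 1))).2.1.trans (hδ (Z i)).2.2.1.symm }, ?_, ?_⟩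
  · intro i x l
    exact (Z i).minimal _ ((hδ (Z i)).2.1 ▸ LinearMap.mem_range_self _ x) l
  · rintro (_ | i) l
    · rw [Nat.cast_zero, zero_add]
      exact h4 l
    · have := (hδ (Z i)).2.2.2.1 l
      rw [hbound] at this
      push_cast
      change (next (Z i)).shift l ≤ _
      linarith

end Minimization

section Koszul

variable {K : Type*} [Field K] {R : Type*} [CommRing R] [Algebra K R]
variable {𝒜 : ℤ → Submodule K R} [GradedAlgebra 𝒜]

/-- Over a Koszul algebra, `reg(mN) ≤ reg(N) + 1`. -/
lemma GRegLE.mIdealG_smul (h0 : 𝒜 0 = 1) (hkos : Koszul 𝒜) {M : Type*} [AddCommGroup M]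
    [Module R M] [Module K M] [IsScalarTower K R M] {ℳ : ℤ → Submodule K M}
    (hcomp : ∀ (i j : ℤ), ∀ r ∈ 𝒜 i, ∀ x ∈ ℳ j, r • x ∈ ℳ (i + j)) {N : Submodule R M} {r : ℤ}
    (h : GRegLE 𝒜 ℳ N r) : GRegLE 𝒜 ℳ (mIdealG 𝒜 • N) (r + 1) := by
  obtain ⟨F, hFmin, hF⟩ := h
  obtain ⟨G, -, hG⟩ := hkos
  have hGσ : ∀ l, G.sh 0 l = 1 := fun l => by simpa using hG 0 l
  have hμ : ∀ d f, (DirectSum.decompose 𝒜 (G.aug f) d : R) =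
      G.aug (component 𝒜 (G.sh 0) d f) := by
    intro d f
    rw [linearMap_eq_sum G.aug f, linearMap_eq_sum G.aug (component 𝒜 (G.sh 0) d f)]
    simp only [component_apply, smul_eq_mul, decompose_sum_apply]
    exact Finset.sum_congr rfl fun l _ => decompose_mul_of_mem (G.aug_hom l)
  let ι := Fin (F.rk 0) × Fin (G.rk 0)
  let s : ι → ℤ := fun p => F.sh 0 p.1 + G.sh 0 p.2
  let γ : (ι → R) →ₗ[R] (Fin (F.rk 0) → R) :=
    LinearMap.pi fun l => G.aug ∘ₗ LinearMap.funLeft R R (Prod.mk l)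
  have hγ : ∀ f l, γ f l = G.aug (f ∘ Prod.mk l) := fun f l => rfl
  have hγg : IsGradedMap 𝒜 s (F.sh 0) γ := by
    intro d f
    ext l
    rw [component_apply, hγ, hμ, hγ]
    congr 1
    ext k
    rw [component_apply, Function.comp_apply, Function.comp_apply, component_apply, sub_sub]
  have hγr : ∀ g : Fin (F.rk 0) → R, (∀ l, g l ∈ mIdealG 𝒜) → ∃ f, γ f = g := by
    intro g hg
    have : ∀ l, ∃ f, G.aug f = g l := fun l => by
      have := hg l
      rw [← G.aug_range] at this
      exact this
    choose f hf using this
    exact ⟨fun p => f p.1 p.2, funext hf⟩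
  have hγm : ∀ f l, γ f l ∈ mIdealG 𝒜 := fun f l => by
    rw [← G.aug_range]
    exact ⟨_, rfl⟩
  have hFker : ∀ g ∈ LinearMap.ker F.aug, ∀ l, g l ∈ mIdealG 𝒜 := by
    intro g hg l
    rw [← F.ex0] at hg
    obtain ⟨x, rfl⟩ := hg
    exact hFmin 0 x l
  have hFhom : IsHomogeneousSub 𝒜 (F.sh 0) (LinearMap.ker F.aug) := by
    rw [← F.ex0]
    exact (isGradedMap_of_single (F.diff_hom 0)).isHomogeneousSub_range
  have hrange : LinearMap.range (F.aug ∘ₗ γ) = mIdealG 𝒜 • N := by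
    apply le_antisymm
    · rintro _ ⟨f, rfl⟩
      rw [LinearMap.comp_apply, linearMap_eq_sum F.aug]
      refine Submodule.sum_mem _ fun l _ => Submodule.smul_mem_smul (hγm f l) ?_
      exact F.aug_range.le ⟨_, rfl⟩
    · rw [Submodule.smul_le]
      intro c hc x hx
      rw [← F.aug_range] at hx
      obtain ⟨g, rfl⟩ := hx
      obtain ⟨f, hf⟩ := hγr (c • g) fun l => Ideal.mul_mem_right _ _ hc
      exact ⟨f, by rw [LinearMap.comp_apply, hf, map_smul]⟩
  have hker : LinearMap.ker (F.aug ∘ₗ γ) = (LinearMap.ker F.aug).comap γ := LinearMap.ker_comp _ _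
  have hhom : IsHomogeneousSub 𝒜 s (LinearMap.ker (F.aug ∘ₗ γ)) :=
    hker ▸ hγg.isHomogeneousSub_comap hFhom
  rw [← hrange]
  refine gRegLE_of_cover h0 (s := s) _ ?_ hhom ?_ ?_
  · intro d f hf
    have hγf : ∀ l, γ f l ∈ 𝒜 (d - F.sh 0 l) := fun l => by
      rw [← hf, ← hγg]
      exact SetLike.coe_mem _
    rw [LinearMap.comp_apply, linearMap_eq_sum F.aug]
    refine Submodule.sum_mem _ fun l _ => ?_
    simpa using hcomp _ _ _ (hγf l) _ (F.aug_hom l)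
  · rintro ⟨l, k⟩
    have := hF 0 l
    simp only [s, hGσ]
    push_cast at this
    linarith
  · refine .horseshoe γ hγg hhom ?_ ?_
    · have h1 := (G.hasBoundedRes (r := 1) fun i l => (hG i l).le).pi
        (t := F.sh 0) (e := r) (fun l => by simpa using hF 0 l)
      rw [G.ex0] at h1
      convert h1 using 1
      · rw [inf_eq_right.2 (LinearMap.ker_le_ker_comp _ _)]
        ext f
        simp only [Submodule.mem_iInf, Submodule.mem_comap, LinearMap.mem_ker]
        exact funext_iff
      · ring
    · have h1 := F.hasBoundedRes hF
      rw [F.ex0] at h1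
      convert h1.mono (r' := r + 1 + 1) (by omega) using 1
      rw [hker, Submodule.map_comap_eq, inf_eq_right]
      exact fun g hg => hγr g (hFker g hg)

end Koszul

section Components

lemma span_iUnion_eq_top {K R M : Type*} [Semiring K] [Semiring R] [AddCommMonoid M] [Module R M]
    [Module K M] (ℳ : ℤ → Submodule K M) [DirectSum.Decomposition ℳ] :
    Submodule.span R (⋃ j, (ℳ j : Set M)) = ⊤ := by
  classical
  refine eq_top_iff.2 fun x _ => ?_
  rw [← DirectSum.sum_support_decompose ℳ x]
  exact Submodule.sum_mem _ fun i _ =>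
    Submodule.subset_span (Set.mem_iUnion.2 ⟨i, SetLike.coe_mem _⟩)

variable {K : Type*} [Field K] {R : Type*} [CommRing R] [Algebra K R]
variable {𝒜 : ℤ → Submodule K R}

lemma mIdealG_eq_span (hstd : IsStdGraded 𝒜) : mIdealG 𝒜 = Ideal.span (𝒜 1 : Set R) := by
  apply le_antisymm
  · refine Ideal.span_le.2 (Set.iUnion_subset ?_)
    rintro ⟨i, hi⟩ x hx
    change x ∈ 𝒜 i at hx
    rcases lt_or_gt_of_ne hi with hi | hi
    · rw [hstd.1 i hi, Submodule.mem_bot] at hx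
      rw [hx]
      exact zero_mem _
    · obtain ⟨n, rfl⟩ : ∃ n : ℕ, i = (n : ℤ) + 1 := ⟨(i - 1).toNat, by omega⟩
      rw [hstd.2.2 n] at hx
      induction hx using Submodule.mul_induction_on' with
      | mem_mul_mem a ha b _ => exact Ideal.mul_mem_right _ _ (Ideal.subset_span ha)
      | add a _ b _ ha hb => exact add_mem ha hb
  · exact Ideal.span_mono (Set.subset_iUnion (fun i : {i : ℤ // i ≠ 0} => (𝒜 i.1 : Set R))
      ⟨1, one_ne_zero⟩)

variable {M : Type*} [AddCommGroup M] [Module R M] [Module K M] {ℳ : ℤ → Submodule K M}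

lemma gRegLE_bot [IsScalarTower K R M] (r : ℤ) : GRegLE 𝒜 ℳ (⊥ : Submodule R M) r :=
  ⟨{ rk := fun _ => 0
     sh := fun _ l => l.elim0
     aug := 0
     diff := fun _ => 0
     aug_range := LinearMap.range_zero
     aug_hom := fun l => l.elim0
     diff_hom := fun _ l => l.elim0
     ex0 := Subsingleton.elim _ _
     exs := fun _ => Subsingleton.elim _ _ }, fun _ _ l => l.elim0, fun _ l => l.elim0⟩

variable [GradedAlgebra 𝒜] [DirectSum.Decomposition ℳ]

lemma decompose_smul_of_mem (hcomp : ∀ (i j : ℤ), ∀ r ∈ 𝒜 i, ∀ x ∈ ℳ j, r • x ∈ ℳ (i + j))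
    (c : R) {j : ℤ} {y : M} (hy : y ∈ ℳ j) (a : ℤ) :
    (DirectSum.decompose ℳ (c • y) a : M) = (DirectSum.decompose 𝒜 c (a - j) : R) • y := by
  induction c using DirectSum.Decomposition.inductionOn 𝒜 with
  | zero => simp
  | @homogeneous i c =>
    have hc := hcomp i j _ c.2 y hy
    by_cases h : i + j = a
    · subst h
      rw [DirectSum.decompose_of_mem_same ℳ hc, add_sub_cancel_right,
        DirectSum.decompose_of_mem_same 𝒜 c.2]
    · rw [DirectSum.decompose_of_mem_ne ℳ hc h,
        DirectSum.decompose_of_mem_ne 𝒜 c.2 (fun h' => h (by omega)), zero_smul]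
  | add c c' h h' =>
    simp only [add_smul, DirectSum.decompose_add, DirectSum.add_apply, Submodule.coe_add, h, h']

/-- A finitely generated graded module vanishes in sufficiently negative degrees. -/
lemma exists_forall_lt_eq_bot [Module.Finite R M] (hneg : ∀ i : ℤ, i < 0 → 𝒜 i = ⊥)
    (hcomp : ∀ (i j : ℤ), ∀ r ∈ 𝒜 i, ∀ x ∈ ℳ j, r • x ∈ ℳ (i + j)) :
    ∃ b : ℤ, ∀ a < b, ℳ a = ⊥ := by
  let P : ℤ → Submodule R M := fun b => Submodule.span R (⋃ j : {j : ℤ // b ≤ j}, (ℳ j.1 : Set M))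
  have hmono : ∀ {b c : ℤ}, b ≤ c → P c ≤ P b := fun {b c} hbc =>
    Submodule.span_mono (Set.iUnion_subset fun j =>
      Set.subset_iUnion (fun j : {j : ℤ // b ≤ j} => (ℳ j.1 : Set M)) ⟨j.1, hbc.trans j.2⟩)
  have hdir : Directed (· ≤ ·) P := fun b c =>
    ⟨min b c, hmono (min_le_left _ _), hmono (min_le_right _ _)⟩
  have hsup : (⊤ : Submodule R M) ≤ ⨆ b, P b := by
    rw [← span_iUnion_eq_top ℳ, Submodule.span_le]
    refine Set.iUnion_subset fun j => ?_
    refine Set.Subset.trans ?_ (SetLike.coe_subset_coe.2 (le_iSup P j))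
    exact Set.Subset.trans (Set.subset_iUnion (fun i : {i : ℤ // j ≤ i} => (ℳ i.1 : Set M))
      ⟨j, le_rfl⟩) Submodule.subset_span
  obtain ⟨_, ⟨b, rfl⟩, hb⟩ := (Submodule.fg_iff_compact _).1
    (Module.Finite.fg_top (R := R) (M := M)) (Set.range P) _ (Set.range_nonempty P)
    hdir.directedOn_range isLUB_iSup hsup
  refine ⟨b, fun a hab => (Submodule.eq_bot_iff _).2 fun x hx => ?_⟩
  have hxP : x ∈ P b := hb trivial
  rw [← DirectSum.decompose_of_mem_same ℳ hx]
  clear hx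
  induction hxP using Submodule.closure_induction with
  | zero => simp
  | add x y _ _ hx hy => simp [hx, hy]
  | smul_mem c x hx =>
    obtain ⟨⟨j, hj⟩, hx⟩ := Set.mem_iUnion.1 hx
    rw [decompose_smul_of_mem hcomp c hx]
    have hc : (DirectSum.decompose 𝒜 c (a - j) : R) = 0 :=
      (Submodule.eq_bot_iff _).1 (hneg (a - j) (by omega)) _ (SetLike.coe_mem _)
    rw [hc, zero_smul]

variable [IsScalarTower K R M]

/-- If `M` has no minimal generators in degree `a`, then `M_{⟨a⟩} = m M_{⟨a-1⟩}`. -/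
lemma gcomp_eq_mIdealG_smul (hstd : IsStdGraded 𝒜)
    (hcomp : ∀ (i j : ℤ), ∀ r ∈ 𝒜 i, ∀ x ∈ ℳ j, r • x ∈ ℳ (i + j)) {a : ℤ}
    (ha : (ℳ a : Set M) ⊆ (mIdealG 𝒜 • (⊤ : Submodule R M) : Submodule R M)) :
    gcomp ℳ a = mIdealG 𝒜 • (gcomp ℳ (a - 1) : Submodule R M) := by
  rw [mIdealG_eq_span hstd] at ha ⊢
  apply le_antisymm
  · refine Submodule.span_le.2 fun x hx => ?_
    have hx' := ha hx
    rw [← span_iUnion_eq_top ℳ, Ideal.span, Submodule.span_smul_span] at hx'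
    rw [← DirectSum.decompose_of_mem_same ℳ hx]
    clear hx
    induction hx' using Submodule.closure_induction with
    | zero => simp
    | add x y _ _ hx hy => simpa using add_mem hx hy
    | smul_mem c x hx =>
      obtain ⟨b, hb, y, hy, rfl⟩ := Set.mem_smul.1 hx
      obtain ⟨j, hy⟩ := Set.mem_iUnion.1 hy
      rw [decompose_smul_of_mem hcomp c (hcomp 1 j b hb y hy), smul_comm]
      refine Submodule.smul_mem_smul (Ideal.subset_span hb) (Submodule.subset_span ?_)
      have hcy := hcomp _ _ _ (SetLike.coe_mem (DirectSum.decompose 𝒜 c (a - (1 + j)))) y hy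
      rwa [show a - (1 + j) + j = a - 1 by ring] at hcy
  · rw [gcomp, Ideal.span, Submodule.span_smul_span]
    refine Submodule.span_le.2 fun x hx => ?_
    obtain ⟨b, hb, y, hy, rfl⟩ := Set.mem_smul.1 hx
    apply Submodule.subset_span
    simpa using hcomp 1 (a - 1) b hb y hy

end Components

/-- Over a Koszul standard graded `K`-algebra,
`creg(M) = max{ reg(M_{⟨d⟩}) − d : β_{0d}(M) ≠ 0 }`: for every `r`, `M` is
`r`-componentwise regular if and only if `reg(M_{⟨d⟩}) ≤ d + r` for every `d`
in which `M` has a minimal generator (i.e. `ℳ d ⊄ mM`). -/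
theorem creg_attained_on_generating_degrees
    {K : Type*} [Field K] {R : Type*} [CommRing R] [Algebra K R]
    (𝒜 : ℤ → Submodule K R) [GradedAlgebra 𝒜]
    (hstd : IsStdGraded 𝒜) (hkos : Koszul 𝒜)
    {M : Type*} [AddCommGroup M] [Module R M] [Module K M] [IsScalarTower K R M]
    [Module.Finite R M]
    (ℳ : ℤ → Submodule K M) (hint : DirectSum.IsInternal ℳ)
    (hcomp : ∀ (i j : ℤ), ∀ r ∈ 𝒜 i, ∀ x ∈ ℳ j, r • x ∈ ℳ (i + j))
    (r : ℤ) :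
    (∀ a : ℤ, GRegLE 𝒜 ℳ (gcomp ℳ a) (a + r)) ↔
    (∀ a : ℤ, ¬ ((ℳ a : Set M) ⊆ (mIdealG 𝒜 • (⊤ : Submodule R M) : Submodule R M)) →
      GRegLE 𝒜 ℳ (gcomp ℳ a) (a + r)) := by
  refine ⟨fun h a _ => h a, fun h => ?_⟩
  let _ := hint.chooseDecomposition
  obtain ⟨b, hb⟩ := exists_forall_lt_eq_bot hstd.1 hcomp
  have hbot : ∀ a < b, GRegLE 𝒜 ℳ (gcomp ℳ a) (a + r) := fun a hab => by
    have : (gcomp ℳ a : Submodule R M) = ⊥ := by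
      rw [gcomp, hb a hab, Submodule.bot_coe, Submodule.span_zero_singleton]
    rw [this]
    exact gRegLE_bot _
  have hge : ∀ a, b - 1 ≤ a → GRegLE 𝒜 ℳ (gcomp ℳ a) (a + r) := fun a hab => by
    induction a, hab using Int.leInduction with
    | base => exact hbot _ (by omega)
    | succ a _ ih =>
      by_cases hgen : (ℳ (a + 1) : Set M) ⊆
          (mIdealG 𝒜 • (⊤ : Submodule R M) : Submodule R M)
      · rw [gcomp_eq_mIdealG_smul hstd hcomp hgen, add_sub_cancel_right, add_right_comm]
        exact ih.mIdealG_smul hstd.2.1 hkos hcomp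
      · exact h _ hgen
  intro a
  rcases lt_or_ge a b with hab | hab
  · exact hbot a hab
  · exact hge a (by omega)

end CregPaperG
end
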